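/- arXiv:1004.5273 — 4 statements merged into one kernel-verified Lean document; each statement's English description precedes it below -/
import Mathlib

section
/- Let D be a connected C-homogeneous triangle-free digraph with more than one end. Then for every edge e of D, the underlying undirected graph of the reachability digraph Δ_e is a connected C-homogeneous bipartite graph with respect to the bipartition of its vertices into tails and heads of edges of 𝒜(e). -/
open Set

universe u

/-- The underlying undirected graph of a digraph given by its edge relation. -/
def UG {V : Type u} (E : V → V → Prop) : SimpleGraph V := SimpleGraph.fromRel E

/-- `E` is a digraph edge relation: irreflexive and antisymmetric. -/
def IsDigraph {V : Type u} (E : V → V → Prop) : Prop :=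
  (∀ x, ¬ E x x) ∧ ∀ x y, E x y → ¬ E y x

/-- A ray in a graph: a one-way infinite path. -/
def IsRay {V : Type u} (G : SimpleGraph V) (r : ℕ → V) : Prop :=
  Function.Injective r ∧ ∀ n, G.Adj (r n) (r (n + 1))

/-- A sequence is eventually in a set. -/
def EventuallyIn {V : Type u} (r : ℕ → V) (C : Set V) : Prop :=
  ∃ N, ∀ n, N ≤ n → r n ∈ C

/-- `C` is a connected component of the subgraph of `G` induced on `W`:
a maximal connected subset of `W`. -/
def IsCompOf {V : Type u} (G : SimpleGraph V) (C W : Set V) : Prop :=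
  C.Nonempty ∧ C ⊆ W ∧ (G.induce C).Connected ∧
    ∀ C', C ⊆ C' → C' ⊆ W → (G.induce C').Connected → C' = C

/-- Two rays are equivalent if for every finite vertex set `S` they lie eventually
in the same component of the graph minus `S`. -/
def RayEquiv {V : Type u} (G : SimpleGraph V) (r r' : ℕ → V) : Prop :=
  ∀ S : Finset V, ∃ C : Set V, IsCompOf G C {v | v ∉ S} ∧
    EventuallyIn r C ∧ EventuallyIn r' C

/-- The graph has more than one end: two inequivalent rays. -/
def MoreThanOneEnd {V : Type u} (G : SimpleGraph V) : Prop :=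
  ∃ r r' : ℕ → V, IsRay G r ∧ IsRay G r' ∧ ¬ RayEquiv G r r'

/-- The graph has infinitely many ends: arbitrarily large families of pairwise
inequivalent rays. -/
def InfinitelyManyEnds {V : Type u} (G : SimpleGraph V) : Prop :=
  ∀ n : ℕ, ∃ f : Fin n → (ℕ → V), (∀ i, IsRay G (f i)) ∧
    ∀ i j, i ≠ j → ¬ RayEquiv G (f i) (f j)

/-- A separation of a graph: a pair of vertex sets covering `V` such that every
edge lies within one side. -/
def IsSeparation {V : Type u} (G : SimpleGraph V) (c : Set V × Set V) : Prop :=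
  c.1 ∪ c.2 = univ ∧ ∀ x y, G.Adj x y → (x ∈ c.1 ∧ y ∈ c.1) ∨ (x ∈ c.2 ∧ y ∈ c.2)

/-- The order of a separation: the number of vertices in its separator. -/
noncomputable def sepOrder {V : Type u} (c : Set V × Set V) : ℕ := (c.1 ∩ c.2).ncard

/-- The neighbourhood of a vertex set. -/
def Nbhd {V : Type u} (G : SimpleGraph V) (A : Set V) : Set V :=
  {v | v ∉ A ∧ ∃ u ∈ A, G.Adj u v}

/-- The separation `(A, ∼)`. -/
def tildeSep {V : Type u} (G : SimpleGraph V) (A : Set V) : Set V × Set V :=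
  (A, Aᶜ ∪ Nbhd G Aᶜ)

/-- `S` separates the wings of the separation `c`: every walk from one wing to
the other meets `S`. -/
def SeparatesWings {V : Type u} (G : SimpleGraph V) (c : Set V × Set V) (S : Set V) : Prop :=
  ∀ a ∈ c.1 \ c.2, ∀ b ∈ c.2 \ c.1, ∀ w : G.Walk a b, ∃ v ∈ w.support, v ∈ S

/-- A separation of finite order with non-empty wings is essential if its first wing is
connected and no proper subset of the separator separates the wings. -/
def IsEssential {V : Type u} (G : SimpleGraph V) (c : Set V × Set V) : Prop :=
  IsSeparation G c ∧ (c.1 ∩ c.2).Finite ∧ (c.1 \ c.2).Nonempty ∧ (c.2 \ c.1).Nonempty ∧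
  (G.induce (c.1 \ c.2)).Connected ∧
  ∀ S, S ⊂ c.1 ∩ c.2 → ¬ SeparatesWings G c S

/-- `C` is a wing of some separation in `𝒞`. -/
def IsWingOf {V : Type u} (𝒞 : Set (Set V × Set V)) (C : Set V) : Prop :=
  ∃ d ∈ 𝒞, C = d.1 \ d.2 ∨ C = d.2 \ d.1

/-- A cut system. -/
def IsCutSystem {V : Type u} (G : SimpleGraph V) (𝒞 : Set (Set V × Set V)) : Prop :=
  𝒞.Nonempty ∧ (∀ c ∈ 𝒞, IsEssential G c) ∧
  (∀ c ∈ 𝒞, ∃ d ∈ 𝒞, d.1 ⊆ c.2) ∧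
  (∀ c ∈ 𝒞, ∀ C : Set V, IsCompOf G C (c.2 \ c.1) →
    (∃ d ∈ 𝒞, d.1 \ d.2 ⊆ C) → tildeSep G (C ∪ Nbhd G C) ∈ 𝒞) ∧
  (∀ c ∈ 𝒞, ∀ c' ∈ 𝒞, ∃ C₁ C₂ : Set V,
    ((IsCompOf G C₁ ((c.1 \ c.2) ∩ (c'.1 \ c'.2)) ∧
      IsCompOf G C₂ ((c.2 \ c.1) ∩ (c'.2 \ c'.1))) ∨
     (IsCompOf G C₁ ((c.2 \ c.1) ∩ (c'.1 \ c'.2)) ∧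
      IsCompOf G C₂ ((c.1 \ c.2) ∩ (c'.2 \ c'.1)))) ∧
    IsWingOf 𝒞 C₁ ∧ IsWingOf 𝒞 C₂)

/-- Pick a side of a separation. -/
def pickSide {V : Type u} (c : Set V × Set V) : Bool → Set V
  | false => c.1
  | true => c.2

/-- Two cuts are nested (with respect to the cut system `𝒞`). -/
def NestedPair {V : Type u} (G : SimpleGraph V) (𝒞 : Set (Set V × Set V))
    (c d : Set V × Set V) : Prop :=
  ∃ i j : Bool,
    ((¬ ∃ C, IsCompOf G C ((tildeSep G (pickSide c i ∩ pickSide d j)).1 \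
        (tildeSep G (pickSide c i ∩ pickSide d j)).2) ∧
        tildeSep G (C ∪ Nbhd G C) ∈ 𝒞) ∨
     (¬ ∃ C, IsCompOf G C ((tildeSep G (pickSide c i ∩ pickSide d j)).2 \
        (tildeSep G (pickSide c i ∩ pickSide d j)).1) ∧
        tildeSep G (C ∪ Nbhd G C) ∈ 𝒞)) ∧
    (c.1 ∩ c.2) ∪ (d.1 ∩ d.2) ⊆ pickSide c (!i) ∩ pickSide d (!j)

/-- A cut system is nested if each two of its cuts are nested. -/
def IsNestedSystem {V : Type u} (G : SimpleGraph V) (𝒞 : Set (Set V × Set V)) : Prop :=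
  ∀ c ∈ 𝒞, ∀ d ∈ 𝒞, NestedPair G 𝒞 c d

/-- `S` is a `𝒞`-separator. -/
def IsSeparatorOf {V : Type u} (𝒞 : Set (Set V × Set V)) (S : Set V) : Prop :=
  ∃ c ∈ 𝒞, c.1 ∩ c.2 = S

/-- A vertex set contains an end: some ray lies in it. -/
def ContainsEnd {V : Type u} (G : SimpleGraph V) (A : Set V) : Prop :=
  ∃ r : ℕ → V, IsRay G r ∧ ∀ n, r n ∈ A

/-- A basic cut system. -/
def IsBasic {V : Type u} (G : SimpleGraph V) (𝒞 : Set (Set V × Set V)) : Prop :=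
  IsCutSystem G 𝒞 ∧
  (∀ c ∈ 𝒞, ∀ d ∈ 𝒞, ¬ sepOrder c < sepOrder d) ∧
  IsNestedSystem G 𝒞 ∧
  (∀ φ : G ≃g G, ∀ c ∈ 𝒞, ((⇑φ '' c.1, ⇑φ '' c.2) : Set V × Set V) ∈ 𝒞) ∧
  (∀ S S' : Set V, IsSeparatorOf 𝒞 S → IsSeparatorOf 𝒞 S' → ∃ φ : G ≃g G, ⇑φ '' S = S') ∧
  (∀ c ∈ 𝒞, ContainsEnd G c.1 ∧ ContainsEnd G c.2 ∧
    ¬ ∃ d : Set V × Set V, IsSeparation G d ∧ (d.1 ∩ d.2).Finite ∧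
      (d.1 ∩ d.2).ncard < sepOrder c ∧ ContainsEnd G d.1 ∧ ContainsEnd G d.2)

/-- The defining property of a `𝒞`-block. -/
def BlockProp {V : Type u} (𝒞 : Set (Set V × Set V)) (X : Set V) : Prop :=
  (∀ c ∈ 𝒞, (X ⊆ c.1 ∨ X ⊆ c.2) ∧ ¬ (X ⊆ c.1 ∧ X ⊆ c.2)) ∧
  ∃ c ∈ 𝒞, X ⊆ c.1 ∧ c.1 ∩ c.2 ⊆ X

/-- A `𝒞`-block: a maximal vertex set with the block property. -/
def IsCBlock {V : Type u} (𝒞 : Set (Set V × Set V)) (X : Set V) : Prop :=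
  BlockProp 𝒞 X ∧ ∀ X', X ⊆ X' → BlockProp 𝒞 X' → X' = X

/-- A digraph is C-homogeneous: every isomorphism between finite induced
subdigraphs with connected underlying graphs extends to an automorphism. -/
def DigraphCHom {V : Type u} (E : V → V → Prop) : Prop :=
  ∀ (X Y : Set V), X.Finite → Y.Finite → ((UG E).induce X).Connected →
  ∀ φ : X ≃ Y, (∀ a b : X, E a.1 b.1 ↔ E (φ a).1 (φ b).1) →
  ∃ ψ : Equiv.Perm V, (∀ x y, E (ψ x) (ψ y) ↔ E x y) ∧ ∀ a : X, ψ a.1 = (φ a).1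

/-- A graph is C-homogeneous: every isomorphism between finite connected induced
subgraphs extends to an automorphism. -/
def GraphCHom {V : Type u} (G : SimpleGraph V) : Prop :=
  ∀ (X Y : Set V), X.Finite → Y.Finite → (G.induce X).Connected →
  ∀ φ : X ≃ Y, (∀ a b : X, G.Adj a.1 b.1 ↔ G.Adj (φ a).1 (φ b).1) →
  ∃ ψ : G ≃g G, ∀ a : X, ψ a.1 = (φ a).1

/-- The digraph contains a triangle: three pairwise adjacent vertices. -/
def HasTriangle {V : Type u} (E : V → V → Prop) : Prop :=
  ∃ x y z : V, (UG E).Adj x y ∧ (UG E).Adj y z ∧ (UG E).Adj x z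

/-- An `n`-arc: a directed path `p 0, p 1, …, p n`. -/
def IsArc {V : Type u} (E : V → V → Prop) (n : ℕ) (p : ℕ → V) : Prop :=
  (∀ i j, i ≤ n → j ≤ n → p i = p j → i = j) ∧ ∀ i < n, E (p i) (p (i + 1))

/-- A digraph is highly-arc-transitive: for every `n`, its automorphism group acts
transitively on `n`-arcs. -/
def HighlyArcTransitive {V : Type u} (E : V → V → Prop) : Prop :=
  ∀ n : ℕ, ∀ p q : ℕ → V, IsArc E n p → IsArc E n q →
  ∃ ψ : Equiv.Perm V, (∀ x y, E (ψ x) (ψ y) ↔ E x y) ∧ ∀ i ≤ n, ψ (p i) = q i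

/-- An alternating walk `w 0, …, w n` in a digraph. -/
def IsAltWalk {V : Type u} (E : V → V → Prop) (n : ℕ) (w : ℕ → V) : Prop :=
  (∀ i < n, E (w i) (w (i + 1)) ∨ E (w (i + 1)) (w i)) ∧
  ∀ i, i + 2 ≤ n → (E (w i) (w (i + 1)) ↔ E (w (i + 2)) (w (i + 1)))

/-- The edge `e` lies on the walk `w 0, …, w n` (in either direction). -/
def EdgeOnWalk {V : Type u} (n : ℕ) (w : ℕ → V) (e : V × V) : Prop :=
  ∃ i < n, (w i = e.1 ∧ w (i + 1) = e.2) ∨ (w i = e.2 ∧ w (i + 1) = e.1)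

/-- Two edges are reachable from each other: they lie on a common alternating walk. -/
def Reach {V : Type u} (E : V → V → Prop) (e f : V × V) : Prop :=
  ∃ n w, IsAltWalk E n w ∧ EdgeOnWalk n w e ∧ EdgeOnWalk n w f

/-- The edge relation of the reachability digraph `Δ_e`. -/
def DeltaRel {V : Type u} (E : V → V → Prop) (e : V × V) : V → V → Prop :=
  fun x y => E x y ∧ Reach E e (x, y)

/-- The underlying undirected graph of the reachability digraph `Δ_e`. -/
def DeltaGraph {V : Type u} (E : V → V → Prop) (e : V × V) : SimpleGraph V :=
  UG (DeltaRel E e)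

/-- Tails of edges of `𝒜(e)`. -/
def Tails {V : Type u} (E : V → V → Prop) (e : V × V) : Set V :=
  {x | ∃ y, DeltaRel E e x y}

/-- Heads of edges of `𝒜(e)`. -/
def Heads {V : Type u} (E : V → V → Prop) (e : V × V) : Set V :=
  {y | ∃ x, DeltaRel E e x y}

/-- The set of descendants of a vertex. -/
def Descendants {V : Type u} (E : V → V → Prop) (x : V) : Set V :=
  {y | ∃ n p, IsArc E n p ∧ p 0 = x ∧ p n = y}

/-- `(X, Y)` is a bipartition of the graph `G`. -/
def IsBipartition {V : Type u} (G : SimpleGraph V) (X Y : Set V) : Prop :=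
  X ∪ Y = univ ∧ Disjoint X Y ∧
  ∀ a b, G.Adj a b → (a ∈ X ∧ b ∈ Y) ∨ (a ∈ Y ∧ b ∈ X)

/-- `G` with sides `X`, `Y` is C-homogeneous bipartite: every isomorphism between
finite connected induced subgraphs preserving the sides extends to a side-preserving
automorphism. -/
def BipCHom {V : Type u} (G : SimpleGraph V) (X Y : Set V) : Prop :=
  ∀ (A B : Set V), A.Finite → B.Finite → (G.induce A).Connected →
  ∀ φ : A ≃ B, (∀ a b : A, G.Adj a.1 b.1 ↔ G.Adj (φ a).1 (φ b).1) →
  (∀ a : A, a.1 ∈ X ↔ (φ a).1 ∈ X) → (∀ a : A, a.1 ∈ Y ↔ (φ a).1 ∈ Y) →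
  ∃ ψ : G ≃g G, (∀ v, v ∈ X ↔ ψ v ∈ X) ∧ (∀ v, v ∈ Y ↔ ψ v ∈ Y) ∧
    ∀ a : A, ψ a.1 = (φ a).1

/-- `G` with sides `X`, `Y` is homogeneous bipartite: every isomorphism between
finite induced subgraphs preserving the sides extends to a side-preserving
automorphism. -/
def BipHom {V : Type u} (G : SimpleGraph V) (X Y : Set V) : Prop :=
  ∀ (A B : Set V), A.Finite → B.Finite →
  ∀ φ : A ≃ B, (∀ a b : A, G.Adj a.1 b.1 ↔ G.Adj (φ a).1 (φ b).1) →
  (∀ a : A, a.1 ∈ X ↔ (φ a).1 ∈ X) → (∀ a : A, a.1 ∈ Y ↔ (φ a).1 ∈ Y) →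
  ∃ ψ : G ≃g G, (∀ v, v ∈ X ↔ ψ v ∈ X) ∧ (∀ v, v ∈ Y ↔ ψ v ∈ Y) ∧
    ∀ a : A, ψ a.1 = (φ a).1

/-- `G` with sides `X`, `Y` is generic bipartite. -/
def GenericBip {V : Type u} (G : SimpleGraph V) (X Y : Set V) : Prop :=
  (∀ U W : Set V, U ⊆ X → W ⊆ X → U.Finite → W.Finite → Disjoint U W →
    ∃ v ∈ Y, (∀ u ∈ U, G.Adj v u) ∧ ∀ w ∈ W, ¬ G.Adj v w) ∧
  (∀ U W : Set V, U ⊆ Y → W ⊆ Y → U.Finite → W.Finite → Disjoint U W →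
    ∃ v ∈ X, (∀ u ∈ U, G.Adj v u) ∧ ∀ w ∈ W, ¬ G.Adj v w)

section Basics

variable {V : Type u} {E : V → V → Prop}

/-- `ψ` is an automorphism of the digraph `E`. -/
def IsAut (E : V → V → Prop) (ψ : Equiv.Perm V) : Prop :=
  ∀ x y, E (ψ x) (ψ y) ↔ E x y

theorem IsDigraph.ug_adj (hD : IsDigraph E) {x y : V} :
    (UG E).Adj x y ↔ E x y ∨ E y x := by
  simp only [UG, SimpleGraph.fromRel_adj]
  refine ⟨fun h => h.2, fun h => ⟨?_, h⟩⟩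
  rintro rfl
  exact hD.1 _ (h.elim id id)

theorem IsDigraph.ne (hD : IsDigraph E) {x y : V} (h : E x y) : x ≠ y := by
  rintro rfl
  exact hD.1 _ h

theorem IsAut.ug_adj {ψ : Equiv.Perm V} (h : IsAut E ψ) {x y : V} :
    (UG E).Adj (ψ x) (ψ y) ↔ (UG E).Adj x y := by
  simp [UG, SimpleGraph.fromRel_adj, h x y, h y x]

/-- A graph isomorphism induced by a digraph automorphism. -/
def IsAut.ugIso {ψ : Equiv.Perm V} (h : IsAut E ψ) : UG E ≃g UG E :=
  ⟨ψ, h.ug_adj⟩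

theorem IsDigraph.flip (hD : IsDigraph E) : IsDigraph (fun x y => E y x) :=
  ⟨hD.1, fun x y h => hD.2 y x h⟩

theorem ug_flip (E : V → V → Prop) : UG (fun x y => E y x) = UG E := by
  ext x y
  simp [UG, SimpleGraph.fromRel_adj, or_comm]

theorem DigraphCHom.flip (h : DigraphCHom E) : DigraphCHom (fun x y => E y x) := by
  intro X Y hX hY hc φ hφ
  rw [ug_flip] at hc
  obtain ⟨ψ, h1, h2⟩ := h X Y hX hY hc φ (fun a b => hφ b a)
  exact ⟨ψ, fun x y => h1 y x, h2⟩

/-- The sequence `p 0, …, p n` is an induced path of the underlying graph. -/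
def IndPath (E : V → V → Prop) (n : ℕ) (p : ℕ → V) : Prop :=
  (∀ i j, i ≤ n → j ≤ n → p i = p j → i = j) ∧
  (∀ i < n, (UG E).Adj (p i) (p (i + 1))) ∧
  ∀ i j, i ≤ n → j ≤ n → (UG E).Adj (p i) (p j) → j = i + 1 ∨ i = j + 1

theorem IndPath.connected {n : ℕ} {p : ℕ → V} (h : IndPath E n p) :
    ((UG E).induce (p '' {i | i ≤ n})).Connected := by
  have key : ∀ i (hi : i ≤ n), ((UG E).induce (p '' {i | i ≤ n})).Reachable
      ⟨p 0, mem_image_of_mem p (Nat.zero_le n)⟩ ⟨p i, mem_image_of_mem p hi⟩ := by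
    intro i
    induction i with
    | zero => intro _; exact SimpleGraph.Reachable.refl _
    | succ k ih =>
      intro hk
      refine (ih (by omega)).trans (SimpleGraph.Adj.reachable ?_)
      exact h.2.1 k (by omega)
  rw [SimpleGraph.connected_iff_exists_forall_reachable]
  refine ⟨⟨p 0, mem_image_of_mem p (Nat.zero_le n)⟩, ?_⟩
  rintro ⟨_, i, hi, rfl⟩
  exact key i hi

theorem IndPath.exists_aut (hD : IsDigraph E) (hhom : DigraphCHom E) {n : ℕ} {p q : ℕ → V}
    (hp : IndPath E n p) (hq : IndPath E n q)
    (hpq : ∀ i < n, E (p i) (p (i + 1)) ↔ E (q i) (q (i + 1))) :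
    ∃ ψ : Equiv.Perm V, IsAut E ψ ∧ ∀ i ≤ n, ψ (p i) = q i := by
  have hE : ∀ i j, i ≤ n → j ≤ n → (E (p i) (p j) ↔ E (q i) (q j)) := by
    have main : ∀ r : ℕ → V, IndPath E n r → ∀ i j, i ≤ n → j ≤ n → (E (r i) (r j) ↔
        (j = i + 1 ∧ E (r i) (r (i + 1))) ∨ (i = j + 1 ∧ ¬ E (r j) (r (j + 1)))) := by
      intro r hr i j hi hj
      constructor
      · intro h
        rcases hr.2.2 i j hi hj (hD.ug_adj.2 (Or.inl h)) with rfl | rfl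
        · exact Or.inl ⟨rfl, h⟩
        · exact Or.inr ⟨rfl, hD.2 _ _ h⟩
      · rintro (⟨rfl, h⟩ | ⟨rfl, h⟩)
        · exact h
        · exact (hD.ug_adj.1 (hr.2.1 j (by omega))).resolve_left h
    intro i j hi hj
    rw [main p hp i j hi hj, main q hq i j hi hj]
    refine or_congr (and_congr_right fun h => hpq i (by omega))
      (and_congr_right fun h => not_congr (hpq j (by omega)))
  have inj : ∀ r : ℕ → V, IndPath E n r → Set.InjOn r {i | i ≤ n} :=
    fun r hr i hi j hj h => hr.1 i j hi hj h
  let e1 := Equiv.Set.imageOfInjOn p _ (inj p hp)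
  let e2 := Equiv.Set.imageOfInjOn q _ (inj q hq)
  have hfin : {i : ℕ | i ≤ n}.Finite := Set.finite_le_nat n
  obtain ⟨ψ, h1, h2⟩ := hhom (p '' {i | i ≤ n}) (q '' {i | i ≤ n}) (hfin.image _) (hfin.image _)
    hp.connected (e1.symm.trans e2) (by
      intro a b
      obtain ⟨i, rfl⟩ := e1.surjective a
      obtain ⟨j, rfl⟩ := e1.surjective b
      simp only [Equiv.trans_apply, Equiv.symm_apply_apply]
      exact hE i j i.2 j.2)
  refine ⟨ψ, h1, fun i hi => ?_⟩
  have := h2 (e1 ⟨i, hi⟩)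
  simp only [Equiv.trans_apply, Equiv.symm_apply_apply] at this
  exact this

/-- The sequence starting with the entries of a list. -/
def listSeq (l : List V) (d : V) : ℕ → V := fun i => l.getD i d

theorem exists_aut_vertex (hD : IsDigraph E) (hhom : DigraphCHom E) (x x' : V) :
    ∃ ψ : Equiv.Perm V, IsAut E ψ ∧ ψ x = x' := by
  have h : ∀ x, IndPath E 0 (fun _ => x) := by
    intro x
    refine ⟨fun i j hi hj _ => by omega, fun i hi => by omega, fun i j hi hj h => ?_⟩
    exact absurd h ((UG E).irrefl)
  obtain ⟨ψ, h1, h2⟩ := IndPath.exists_aut hD hhom (h x) (h x') (by intro i hi; omega)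
  exact ⟨ψ, h1, h2 0 le_rfl⟩

theorem exists_aut_edge (hD : IsDigraph E) (hhom : DigraphCHom E) {x y x' y' : V}
    (h : E x y) (h' : E x' y') :
    ∃ ψ : Equiv.Perm V, IsAut E ψ ∧ ψ x = x' ∧ ψ y = y' := by
  have key : ∀ x y, E x y → IndPath E 1 (listSeq [x, y] x) := by
    intro x y h
    refine ⟨?_, ?_, ?_⟩
    · intro i j hi hj hij
      interval_cases i <;> interval_cases j <;> simp_all [listSeq, hD.ne h, (hD.ne h).symm]
    · intro i hi
      interval_cases i
      exact hD.ug_adj.2 (Or.inl h)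
    · intro i j hi hj hij
      interval_cases i <;> interval_cases j <;> simp_all [listSeq]
  obtain ⟨ψ, h1, h2⟩ := IndPath.exists_aut hD hhom (key x y h) (key x' y' h')
    (by intro i hi; interval_cases i; exact iff_of_true h h')
  exact ⟨ψ, h1, h2 0 (by omega), h2 1 (by omega)⟩

theorem not_triangle (htf : ¬ HasTriangle E) {x y z : V} (h1 : (UG E).Adj x y)
    (h2 : (UG E).Adj y z) : ¬ (UG E).Adj x z := fun h => htf ⟨x, y, z, h1, h2, h⟩

theorem exists_aut_path₃ (hD : IsDigraph E) (hhom : DigraphCHom E) (htf : ¬ HasTriangle E)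
    {x y z x' y' z' : V} (h1 : (UG E).Adj x y) (h2 : (UG E).Adj y z) (h3 : x ≠ z)
    (h1' : (UG E).Adj x' y') (h2' : (UG E).Adj y' z') (h3' : x' ≠ z')
    (e1 : E x y ↔ E x' y') (e2 : E y z ↔ E y' z') :
    ∃ ψ : Equiv.Perm V, IsAut E ψ ∧ ψ x = x' ∧ ψ y = y' ∧ ψ z = z' := by
  have key : ∀ x y z, (UG E).Adj x y → (UG E).Adj y z → x ≠ z →
      IndPath E 2 (listSeq [x, y, z] x) := by
    intro x y z h1 h2 h3
    have h4 := not_triangle htf h1 h2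
    have h4' : ¬ (UG E).Adj z x := fun h => h4 h.symm
    refine ⟨?_, ?_, ?_⟩
    · intro i j hi hj hij
      have := h1.ne; have := h2.ne; have := h1.ne'; have := h2.ne'; have := h3.symm
      interval_cases i <;> interval_cases j <;> simp_all [listSeq]
    · intro i hi
      interval_cases i
      · exact h1
      · exact h2
    · intro i j hi hj hij
      interval_cases i <;> interval_cases j <;> simp_all [listSeq]
  obtain ⟨ψ, g1, g2⟩ := IndPath.exists_aut hD hhom (key x y z h1 h2 h3) (key x' y' z' h1' h2' h3')
    (by intro i hi; interval_cases i; exacts [e1, e2])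
  exact ⟨ψ, g1, g2 0 (by omega), g2 1 (by omega), g2 2 (by omega)⟩

theorem exists_aut_path₄ (hD : IsDigraph E) (hhom : DigraphCHom E) (htf : ¬ HasTriangle E)
    {x y z w x' y' z' w' : V} (h1 : (UG E).Adj x y) (h2 : (UG E).Adj y z) (h3 : (UG E).Adj z w)
    (h4 : x ≠ z) (h5 : y ≠ w) (h6 : ¬ (UG E).Adj x w)
    (h1' : (UG E).Adj x' y') (h2' : (UG E).Adj y' z') (h3' : (UG E).Adj z' w')
    (h4' : x' ≠ z') (h5' : y' ≠ w') (h6' : ¬ (UG E).Adj x' w')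
    (e1 : E x y ↔ E x' y') (e2 : E y z ↔ E y' z') (e3 : E z w ↔ E z' w') :
    ∃ ψ : Equiv.Perm V, IsAut E ψ ∧ ψ x = x' ∧ ψ y = y' ∧ ψ z = z' ∧ ψ w = w' := by
  have key : ∀ x y z w, (UG E).Adj x y → (UG E).Adj y z → (UG E).Adj z w → x ≠ z → y ≠ w →
      ¬ (UG E).Adj x w → IndPath E 3 (listSeq [x, y, z, w] x) := by
    intro x y z w h1 h2 h3 h4 h5 h6
    have a1 := not_triangle htf h1 h2
    have a2 := not_triangle htf h2 h3
    have n1 : x ≠ w := by rintro rfl; exact a1 h3.symm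
    have b1 : ¬ (UG E).Adj z x := fun h => a1 h.symm
    have b2 : ¬ (UG E).Adj w y := fun h => a2 h.symm
    have b3 : ¬ (UG E).Adj w x := fun h => h6 h.symm
    refine ⟨?_, ?_, ?_⟩
    · intro i j hi hj hij
      have := h1.ne; have := h2.ne; have := h1.ne'; have := h2.ne'; have := h3.ne
      have := h3.ne'; have := h4.symm; have := h5.symm; have := n1.symm
      interval_cases i <;> interval_cases j <;> simp_all [listSeq]
    · intro i hi
      interval_cases i
      · exact h1
      · exact h2
      · exact h3
    · intro i j hi hj hij
      interval_cases i <;> interval_cases j <;> simp_all [listSeq]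
  obtain ⟨ψ, g1, g2⟩ := IndPath.exists_aut hD hhom (key x y z w h1 h2 h3 h4 h5 h6)
    (key x' y' z' w' h1' h2' h3' h4' h5' h6')
    (by intro i hi; interval_cases i; exacts [e1, e2, e3])
  exact ⟨ψ, g1, g2 0 (by omega), g2 1 (by omega), g2 2 (by omega), g2 3 (by omega)⟩

theorem indPath_path₅ (htf : ¬ HasTriangle E)
    {x y z w v : V} (h1 : (UG E).Adj x y) (h2 : (UG E).Adj y z) (h3 : (UG E).Adj z w)
    (h4 : (UG E).Adj w v) (n1 : x ≠ z) (n2 : y ≠ w) (n3 : z ≠ v) (n4 : x ≠ v)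
    (m1 : ¬ (UG E).Adj x w) (m2 : ¬ (UG E).Adj y v) (m3 : ¬ (UG E).Adj x v) :
    IndPath E 4 (listSeq [x, y, z, w, v] x) := by
  have a1 := not_triangle htf h1 h2
  have a2 := not_triangle htf h2 h3
  have a3 := not_triangle htf h3 h4
  have n5 : x ≠ w := by rintro rfl; exact a1 h3.symm
  have n6 : y ≠ v := by rintro rfl; exact a2 h4.symm
  have b1 : ¬ (UG E).Adj z x := fun h => a1 h.symm
  have b2 : ¬ (UG E).Adj w y := fun h => a2 h.symm
  have b3 : ¬ (UG E).Adj v z := fun h => a3 h.symm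
  have b4 : ¬ (UG E).Adj w x := fun h => m1 h.symm
  have b5 : ¬ (UG E).Adj v y := fun h => m2 h.symm
  have b6 : ¬ (UG E).Adj v x := fun h => m3 h.symm
  refine ⟨?_, ?_, ?_⟩
  · intro i j hi hj hij
    have := h1.ne; have := h2.ne; have := h1.ne'; have := h2.ne'; have := h3.ne; have := h4.ne
    have := h3.ne'; have := h4.ne'; have := n1.symm; have := n2.symm; have := n3.symm
    have := n4.symm; have := n5.symm; have := n6.symm
    interval_cases i <;> interval_cases j <;> simp_all [listSeq]
  · intro i hi
    interval_cases i
    · exact h1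
    · exact h2
    · exact h3
    · exact h4
  · intro i j hi hj hij
    interval_cases i <;> interval_cases j <;> simp_all [listSeq]

end Basics

section Alternating

variable {V : Type u} {E : V → V → Prop}

/-- The alternating double cover: two copies of the vertex set, the first for vertices in
their role as tails and the second for vertices in their role as heads. -/
def altGraph (E : V → V → Prop) : SimpleGraph (V × Bool) where
  Adj a b := (a.2 = true ∧ b.2 = false ∧ E a.1 b.1) ∨ (a.2 = false ∧ b.2 = true ∧ E b.1 a.1)
  symm := ⟨by
    rintro a b (⟨h1, h2, h3⟩ | ⟨h1, h2, h3⟩)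
    · exact Or.inr ⟨h2, h1, h3⟩
    · exact Or.inl ⟨h2, h1, h3⟩⟩
  loopless := ⟨by
    rintro a (⟨h1, h2, -⟩ | ⟨h1, h2, -⟩) <;> simp_all⟩

theorem altGraph_adj_true {x y : V} {b : Bool} :
    (altGraph E).Adj (x, true) (y, b) ↔ b = false ∧ E x y := by
  simp [altGraph]

theorem altGraph_adj_false {x y : V} {b : Bool} :
    (altGraph E).Adj (x, false) (y, b) ↔ b = true ∧ E y x := by
  simp [altGraph]

theorem altGraph_adj_snd {a b : V × Bool} (h : (altGraph E).Adj a b) : b.2 = !a.2 := by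
  rcases h with ⟨h1, h2, -⟩ | ⟨h1, h2, -⟩ <;> simp [h1, h2]

theorem altGraph_adj_edge (hD : IsDigraph E) {a b : V × Bool} (h : (altGraph E).Adj a b) :
    E a.1 b.1 ↔ a.2 = true := by
  rcases h with ⟨h1, h2, h3⟩ | ⟨h1, h2, h3⟩
  · simp [h1, h3]
  · simp [h1, hD.2 _ _ h3]

theorem altGraph_adj_ug (hD : IsDigraph E) {a b : V × Bool} (h : (altGraph E).Adj a b) :
    (UG E).Adj a.1 b.1 := by
  rcases h with ⟨-, -, h3⟩ | ⟨-, -, h3⟩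
  · exact hD.ug_adj.2 (Or.inl h3)
  · exact hD.ug_adj.2 (Or.inr h3)

/-- A digraph automorphism lifts to the alternating double cover. -/
def IsAut.altIso {ψ : Equiv.Perm V} (h : IsAut E ψ) : altGraph E ≃g altGraph E where
  toEquiv := Equiv.prodCongr ψ (Equiv.refl Bool)
  map_rel_iff' := by
    rintro ⟨x, b⟩ ⟨y, c⟩
    simp [altGraph, h x y, h y x]

theorem IsAut.altGraph_reachable {ψ : Equiv.Perm V} (h : IsAut E ψ) {x y : V} {b c : Bool} :
    (altGraph E).Reachable (ψ x, b) (ψ y, c) ↔ (altGraph E).Reachable (x, b) (y, c) :=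
  SimpleGraph.Iso.reachable_iff (φ := h.altIso) (u := (x, b)) (v := (y, c))

theorem dist_le_of_hom {α β : Type*} {G : SimpleGraph α} {H : SimpleGraph β} (f : G →g H)
    {a b : α} (h : G.Reachable a b) : H.dist (f a) (f b) ≤ G.dist a b := by
  obtain ⟨w, hw⟩ := h.exists_walk_length_eq_dist
  rw [← hw, ← SimpleGraph.Walk.length_map f w]
  exact SimpleGraph.dist_le _

theorem dist_eq_of_iso {α : Type*} {G : SimpleGraph α} (f : G ≃g G) (a b : α) :
    G.dist (f a) (f b) = G.dist a b := by
  by_cases h : G.Reachable a b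
  · refine le_antisymm (dist_le_of_hom f.toHom h) ?_
    have := dist_le_of_hom f.symm.toHom (f.reachable_iff.2 h)
    simpa using this
  · rw [SimpleGraph.dist_eq_zero_of_not_reachable h,
      SimpleGraph.dist_eq_zero_of_not_reachable (fun h' => h (f.reachable_iff.1 h'))]

theorem IsAut.altGraph_dist {ψ : Equiv.Perm V} (h : IsAut E ψ) (x y : V) (b c : Bool) :
    (altGraph E).dist (ψ x, b) (ψ y, c) = (altGraph E).dist (x, b) (y, c) :=
  dist_eq_of_iso h.altIso (x, b) (y, c)

/-- A geodesic sequence `a 0, …, a n` in a graph. -/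
def IsGeo {α : Type*} (G : SimpleGraph α) (n : ℕ) (a : ℕ → α) : Prop :=
  (∀ i < n, G.Adj (a i) (a (i + 1))) ∧ G.dist (a 0) (a n) = n

section Geo

variable {α : Type*} {G : SimpleGraph α} {n : ℕ} {a : ℕ → α}

theorem exists_isGeo {x y : α} (h : G.Reachable x y) :
    ∃ a, IsGeo G (G.dist x y) a ∧ a 0 = x ∧ a (G.dist x y) = y := by
  obtain ⟨w, hw⟩ := h.exists_walk_length_eq_dist
  have h1 : w.getVert (G.dist x y) = y := by rw [← hw]; exact w.getVert_length
  refine ⟨w.getVert, ⟨fun i hi => w.adj_getVert_succ (by omega), ?_⟩, w.getVert_zero, h1⟩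
  rw [w.getVert_zero, h1]

theorem seq_reachable_dist_le (h : ∀ i < n, G.Adj (a i) (a (i + 1))) (i k : ℕ) (hk : i + k ≤ n) :
    G.Reachable (a i) (a (i + k)) ∧ G.dist (a i) (a (i + k)) ≤ k := by
  induction k with
  | zero => exact ⟨SimpleGraph.Reachable.refl _, by simp⟩
  | succ k ih =>
    obtain ⟨h1, h2⟩ := ih (by omega)
    have h3 := h (i + k) (by omega)
    refine ⟨h1.trans h3.reachable, ?_⟩
    have h4 := h1.dist_triangle_left (a (i + k + 1))
    have h5 := SimpleGraph.dist_eq_one_iff_adj.2 h3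
    rw [h5] at h4
    exact h4.trans (by omega)

theorem IsGeo.reachable (h : IsGeo G n a) {i j : ℕ} (hi : i ≤ n) (hj : j ≤ n) :
    G.Reachable (a i) (a j) := by
  have h1 := (seq_reachable_dist_le h.1 0 i (by omega)).1
  have h2 := (seq_reachable_dist_le h.1 0 j (by omega)).1
  rw [Nat.zero_add] at h1 h2
  exact h1.symm.trans h2

theorem IsGeo.dist_of_le (h : IsGeo G n a) {i j : ℕ} (hij : i ≤ j) (hj : j ≤ n) :
    G.dist (a i) (a j) = j - i := by
  obtain ⟨k, rfl⟩ := Nat.exists_eq_add_of_le hij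
  obtain ⟨m, rfl⟩ := Nat.exists_eq_add_of_le hj
  have h1 := (seq_reachable_dist_le h.1 0 i (by omega)).2
  have h2 := (seq_reachable_dist_le h.1 i k (by omega)).2
  have h3 := (seq_reachable_dist_le h.1 (i + k) m (by omega)).2
  rw [Nat.zero_add] at h1
  have h4 := (h.reachable (Nat.zero_le _) (show i ≤ i + k + m by omega)).dist_triangle_left
    (a (i + k + m))
  have h5 := (h.reachable (show i ≤ i + k + m by omega) hj).dist_triangle_left (a (i + k + m))
  have h6 := h.2
  omega

theorem IsGeo.dist_eq (h : IsGeo G n a) {i j : ℕ} (hi : i ≤ n) (hj : j ≤ n) :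
    G.dist (a i) (a j) = (i - j) + (j - i) := by
  rcases le_total i j with hij | hij
  · rw [h.dist_of_le hij hj]; omega
  · rw [SimpleGraph.dist_comm, h.dist_of_le hij hi]; omega

theorem IsGeo.segment (h : IsGeo G n a) {k m : ℕ} (hk : k + m ≤ n) :
    IsGeo G m (fun i => a (k + i)) := by
  refine ⟨fun i hi => h.1 (k + i) (by omega), ?_⟩
  rw [h.dist_of_le (by omega) hk]
  omega

theorem IsGeo.reverse (h : IsGeo G n a) : IsGeo G n (fun i => a (n - i)) := by
  refine ⟨fun i hi => ?_, ?_⟩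
  · have := (h.1 (n - (i + 1)) (by omega)).symm
    rwa [show n - (i + 1) + 1 = n - i by omega] at this
  · simp only [Nat.sub_zero, Nat.sub_self]
    rw [SimpleGraph.dist_comm, h.2]

end Geo

theorem IsGeo.snd_eq {n : ℕ} {a b : ℕ → V × Bool} (ha : IsGeo (altGraph E) n a)
    (hb : IsGeo (altGraph E) n b) (h0 : (a 0).2 = (b 0).2) (i : ℕ) (hi : i ≤ n) :
    (a i).2 = (b i).2 := by
  induction i with
  | zero => exact h0
  | succ k ih =>
    rw [altGraph_adj_snd (ha.1 k (by omega)), altGraph_adj_snd (hb.1 k (by omega)), ih (by omega)]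

theorem IsGeo.indPath (hD : IsDigraph E) {n : ℕ} {a : ℕ → V × Bool}
    (ha : IsGeo (altGraph E) n a)
    (h0 : ∀ u, (altGraph E).Reachable (u, true) (u, false) →
      n + 1 < (altGraph E).dist (u, true) (u, false))
    (h1 : ∀ u v, E v u → (altGraph E).Reachable (u, true) (v, false) →
      n < (altGraph E).dist (u, true) (v, false)) :
    IndPath E n (fun i => (a i).1) := by
  have h0' : ∀ (u : V) (b c : Bool), b ≠ c → (altGraph E).Reachable (u, b) (u, c) →
      n + 1 < (altGraph E).dist (u, b) (u, c) := by
    intro u b c hbc hr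
    cases b <;> cases c
    · exact absurd rfl hbc
    · rw [SimpleGraph.dist_comm]; exact h0 u hr.symm
    · exact h0 u hr
    · exact absurd rfl hbc
  have key : ∀ i j, i ≤ n → j ≤ n → E (a i).1 (a j).1 → j = i + 1 ∨ i = j + 1 := by
    intro i j hi hj hij
    have hr := ha.reachable hi hj
    have hd := ha.dist_eq hi hj
    generalize a i = x at *
    generalize a j = y at *
    obtain ⟨x, b⟩ := x
    obtain ⟨y, c⟩ := y
    simp only at hij
    by_cases hbc : b = c
    · subst hbc
      exfalso
      cases b
      · have hadj : (altGraph E).Adj (y, false) (x, true) := altGraph_adj_false.2 ⟨rfl, hij⟩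
        have := h0' x false true (by simp) (hr.trans hadj.reachable)
        have h3 := hr.dist_triangle_left (x, true)
        rw [SimpleGraph.dist_eq_one_iff_adj.2 hadj] at h3
        omega
      · have hadj : (altGraph E).Adj (y, false) (x, true) := altGraph_adj_false.2 ⟨rfl, hij⟩
        have := h0' y true false (by simp) (hr.symm.trans hadj.symm.reachable)
        have h3 := hr.symm.dist_triangle_left (y, false)
        rw [SimpleGraph.dist_eq_one_iff_adj.2 hadj.symm] at h3
        rw [SimpleGraph.dist_comm] at hd
        omega
    · cases b <;> cases c
      · exact absurd rfl hbc
      · exfalso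
        have := h1 y x hij hr.symm
        rw [SimpleGraph.dist_comm] at this
        omega
      · have hadj : (altGraph E).Adj (x, true) (y, false) := altGraph_adj_true.2 ⟨rfl, hij⟩
        rw [SimpleGraph.dist_eq_one_iff_adj.2 hadj] at hd
        omega
      · exact absurd rfl hbc
  refine ⟨?_, fun i hi => altGraph_adj_ug hD (ha.1 i hi), ?_⟩
  · intro i j hi hj hij
    have hr := ha.reachable hi hj
    have hd := ha.dist_eq hi hj
    simp only at hij
    by_cases hbc : (a i).2 = (a j).2
    · rw [Prod.ext hij hbc, SimpleGraph.dist_self] at hd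
      omega
    · exfalso
      have e1 : a i = ((a i).1, (a i).2) := rfl
      have e2 : a j = ((a i).1, (a j).2) := Prod.ext hij.symm rfl
      rw [e1, e2] at hr hd
      have := h0' _ _ _ hbc hr
      omega
  · intro i j hi hj hij
    rcases hD.ug_adj.1 hij with h | h
    · exact key i j hi hj h
    · exact (key j i hj hi h).symm

theorem IsGeo.exists_aut (hD : IsDigraph E) (hhom : DigraphCHom E) {n : ℕ}
    {a b : ℕ → V × Bool} (ha : IsGeo (altGraph E) n a) (hb : IsGeo (altGraph E) n b)
    (hab : (a 0).2 = (b 0).2)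
    (h0 : ∀ u, (altGraph E).Reachable (u, true) (u, false) →
      n + 1 < (altGraph E).dist (u, true) (u, false))
    (h1 : ∀ u v, E v u → (altGraph E).Reachable (u, true) (v, false) →
      n < (altGraph E).dist (u, true) (v, false)) :
    ∃ ψ : Equiv.Perm V, IsAut E ψ ∧ ∀ i ≤ n, ψ (a i).1 = (b i).1 := by
  refine IndPath.exists_aut hD hhom (ha.indPath hD h0 h1) (hb.indPath hD h0 h1) fun i hi => ?_
  rw [altGraph_adj_edge hD (ha.1 i hi), altGraph_adj_edge hD (hb.1 i hi),
    ha.snd_eq hb hab i (by omega)]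

/-- A geodesic of length `L` in the alternating double cover joining the tail copy of a vertex
to the head copy of one of its in-neighbours, where `L` is smallest possible and smaller than
every distance between the two copies of a vertex. -/
structure IsMinBackGeo (E : V → V → Prop) (L : ℕ) (a : ℕ → V × Bool) : Prop where
  two_le : 2 ≤ L
  geo : IsGeo (altGraph E) L a
  snd_zero : (a 0).2 = true
  snd_last : (a L).2 = false
  back : E (a L).1 (a 0).1
  lt_dist : ∀ u, (altGraph E).Reachable (u, true) (u, false) →
    L < (altGraph E).dist (u, true) (u, false)
  le_dist : ∀ u v, E v u → (altGraph E).Reachable (u, true) (v, false) →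
    L ≤ (altGraph E).dist (u, true) (v, false)

theorem IsMinBackGeo.exists_aut (hD : IsDigraph E) (hhom : DigraphCHom E) {L : ℕ}
    {a : ℕ → V × Bool} (h : IsMinBackGeo E L a) {b c : ℕ → V × Bool}
    (hb : IsGeo (altGraph E) (L - 1) b) (hc : IsGeo (altGraph E) (L - 1) c)
    (hbc : (b 0).2 = (c 0).2) :
    ∃ ψ : Equiv.Perm V, IsAut E ψ ∧ ∀ i ≤ L - 1, ψ (b i).1 = (c i).1 := by
  have := h.two_le
  refine hb.exists_aut hD hhom hc hbc (fun u hu => ?_) (fun u v huv hr => ?_)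
  · have := h.lt_dist u hu
    omega
  · have := h.le_dist u v huv hr
    omega

theorem IsMinBackGeo.exists_four_cycle (hD : IsDigraph E) (hhom : DigraphCHom E) {L : ℕ}
    {a : ℕ → V × Bool} (h : IsMinBackGeo E L a) :
    ∃ x y z d, E x y ∧ E y z ∧ E z d ∧ E d x := by
  have hL := h.two_le
  have g1 : IsGeo (altGraph E) (L - 1) (fun i => a (1 + i)) := h.geo.segment (by omega)
  have g2 := g1.reverse
  have b1 : (a 1).2 = false := by
    rw [altGraph_adj_snd (h.geo.1 0 (by omega)), h.snd_zero]; rfl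
  obtain ⟨ψ, hψ, hm⟩ := h.exists_aut hD hhom g1 g2 (by
    simp only [Nat.sub_zero, show 1 + (L - 1) = L by omega, h.snd_last, Nat.add_zero, b1])
  have m1 : ψ (a 1).1 = (a L).1 := by
    have := hm 0 (by omega)
    simpa [show 1 + (L - 1) = L by omega] using this
  have m2 : ψ (a L).1 = (a 1).1 := by
    have := hm (L - 1) le_rfl
    simpa [show 1 + (L - 1) = L by omega] using this
  have e01 : E (a 0).1 (a 1).1 :=
    (altGraph_adj_edge hD (h.geo.1 0 (by omega))).2 h.snd_zero
  have f1 := (hψ _ _).2 h.back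
  have f2 := (hψ _ _).2 e01
  rw [m2] at f1
  rw [m1] at f2
  exact ⟨_, _, _, _, f1, f2, h.back, e01⟩

/-- `E` contains a copy of the 4-cycle having a directed path of length three and one edge
from its first to its last vertex. -/
def HasShortcut (E : V → V → Prop) : Prop :=
  ∃ a b c d, E a b ∧ E b c ∧ E c d ∧ E a d

/-- The alternating double cover separates the two copies of each vertex, and the tail copy of
each vertex from the head copies of its in-neighbours. -/
def AltSeparated (E : V → V → Prop) : Prop :=
  (∀ v, ¬ (altGraph E).Reachable (v, true) (v, false)) ∧
  ∀ u v, E v u → ¬ (altGraph E).Reachable (u, true) (v, false)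

theorem hasShortcut_of_closed_geo (hD : IsDigraph E) (hhom : DigraphCHom E) {L : ℕ} {w : V}
    (hr : (altGraph E).Reachable (w, true) (w, false))
    (hL : (altGraph E).dist (w, true) (w, false) = L)
    (h0 : ∀ u, (altGraph E).Reachable (u, true) (u, false) →
      L ≤ (altGraph E).dist (u, true) (u, false))
    (h1 : ∀ u v, E v u → (altGraph E).Reachable (u, true) (v, false) →
      L ≤ (altGraph E).dist (u, true) (v, false)) : HasShortcut E := by
  obtain ⟨a, ha, a0, aL⟩ := exists_isGeo hr
  rw [hL] at ha aL
  have L0 : L ≠ 0 := by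
    rintro rfl
    rw [a0] at aL
    simp at aL
  have e01 : E (a 0).1 (a 1).1 := (altGraph_adj_edge hD (ha.1 0 (by omega))).2 (by rw [a0])
  have L1 : L ≠ 1 := by
    rintro rfl
    rw [a0, aL] at e01
    exact hD.1 _ e01
  have hA := ha.1 (L - 1) (by omega)
  rw [show L - 1 + 1 = L by omega] at hA
  have bL : (a (L - 1)).2 = true := by
    have := altGraph_adj_snd hA
    rw [aL] at this
    simpa using this.symm
  have eL : E (a (L - 1)).1 (a L).1 := (altGraph_adj_edge hD hA).2 bL
  have b1 : (a 1).2 = false := by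
    rw [altGraph_adj_snd (ha.1 0 (by omega)), a0]; rfl
  have b2 : (a 2).2 = true := by
    rw [altGraph_adj_snd (ha.1 1 (by omega)), b1]; rfl
  have g1 : IsGeo (altGraph E) (L - 2) (fun i => a (2 + i)) := ha.segment (by omega)
  have g2 : IsGeo (altGraph E) (L - 2) (fun i => a (1 + i)) := ha.segment (by omega)
  have g3 := g2.reverse
  obtain ⟨ψ, hψ, hm⟩ := g1.exists_aut hD hhom g3 (by
      simp only [Nat.sub_zero, show 1 + (L - 2) = L - 1 by omega, bL, Nat.add_zero, b2])
    (fun u hu => by have := h0 u hu; omega) (fun u v huv hu => by have := h1 u v huv hu; omega)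
  have m1 : ψ (a 2).1 = (a (L - 1)).1 := by
    have := hm 0 (by omega)
    simpa [show 1 + (L - 2) = L - 1 by omega] using this
  have m2 : ψ (a L).1 = (a 1).1 := by
    have := hm (L - 2) le_rfl
    simpa [show 2 + (L - 2) = L by omega] using this
  have e21 : E (a 2).1 (a 1).1 :=
    (altGraph_adj_edge hD (ha.1 1 (by omega)).symm).2 b2
  have f1 := (hψ _ _).2 e21
  have f2 := (hψ _ _).2 e01
  rw [m1] at f1
  have wL : (a L).1 = w := by rw [aL]
  have w0 : (a 0).1 = w := by rw [a0]
  rw [w0, ← wL, m2] at f2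
  rw [w0, ← wL] at e01
  exact ⟨_, _, _, _, eL, e01, f2, f1⟩

theorem altSeparated_or (hD : IsDigraph E) (hhom : DigraphCHom E) :
    AltSeparated E ∨ HasShortcut E ∨ ∃ L a, IsMinBackGeo E L a := by
  classical
  by_cases hs : AltSeparated E
  · exact Or.inl hs
  right
  let P0 : ℕ → Prop := fun n => ∃ u, (altGraph E).Reachable (u, true) (u, false) ∧
    (altGraph E).dist (u, true) (u, false) = n
  let P1 : ℕ → Prop := fun n => ∃ u v, E v u ∧ (altGraph E).Reachable (u, true) (v, false) ∧
    (altGraph E).dist (u, true) (v, false) = n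
  have hex : ∃ n, P0 n ∨ P1 n := by
    by_contra hcon
    refine hs ⟨fun v hv => hcon ⟨_, Or.inl ⟨v, hv, rfl⟩⟩, fun u v huv hr =>
      hcon ⟨_, Or.inr ⟨u, v, huv, hr, rfl⟩⟩⟩
  have h0 : ∀ u, (altGraph E).Reachable (u, true) (u, false) →
      Nat.find hex ≤ (altGraph E).dist (u, true) (u, false) := fun u hu =>
    Nat.find_min' hex (Or.inl ⟨u, hu, rfl⟩)
  have h1 : ∀ u v, E v u → (altGraph E).Reachable (u, true) (v, false) →
      Nat.find hex ≤ (altGraph E).dist (u, true) (v, false) := fun u v huv hu =>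
    Nat.find_min' hex (Or.inr ⟨u, v, huv, hu, rfl⟩)
  by_cases hP : P0 (Nat.find hex)
  · obtain ⟨w, hr, hL⟩ := hP
    exact Or.inl (hasShortcut_of_closed_geo hD hhom hr hL h0 h1)
  · right
    obtain ⟨u, v, huv, hr, hL⟩ := (Nat.find_spec hex).resolve_left hP
    obtain ⟨a, ha, a0, aL⟩ := exists_isGeo hr
    rw [hL] at ha aL
    refine ⟨Nat.find hex, a, ⟨?_, ha, by rw [a0], by rw [aL], by rw [a0, aL]; exact huv, ?_, h1⟩⟩
    · by_contra hlt
      have hlt : Nat.find hex = 0 ∨ Nat.find hex = 1 := by omega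
      rcases hlt with h | h
      · rw [h, a0] at aL
        simp at aL
      · have := ha.1 0 (by omega)
        rw [h] at aL
        rw [a0, Nat.zero_add, aL, altGraph_adj_true] at this
        exact hD.2 _ _ this.2 huv
    · intro u hu
      refine lt_of_le_of_ne (h0 u hu) fun h => hP ⟨u, hu, h.symm⟩

end Alternating

section Separations

variable {V : Type u} {G : SimpleGraph V}

/-- The finite set `S` separates `A` from `B` in `G`, and the three sets partition the
vertex set. -/
structure IsSplit (G : SimpleGraph V) (S A B : Set V) : Prop where
  finite : S.Finite
  cover : ∀ v, v ∈ S ∨ v ∈ A ∨ v ∈ B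
  left : ∀ v ∈ A, v ∉ S
  right : ∀ v ∈ B, v ∉ S
  disj : ∀ v ∈ A, v ∉ B
  not_adj : ∀ u ∈ A, ∀ v ∈ B, ¬ G.Adj u v

theorem IsSplit.symm {S A B : Set V} (h : IsSplit G S A B) : IsSplit G S B A :=
  ⟨h.finite, fun v => (h.cover v).imp_right Or.symm, h.right, h.left,
    fun v hB hA => h.disj v hA hB, fun u hu v hv huv => h.not_adj v hv u hu huv.symm⟩

/-- `A` is a union of components of `G` minus `S`, and neither empty nor everything. -/
def IsShore (G : SimpleGraph V) (S : Finset V) (A : Set V) : Prop :=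
  A.Nonempty ∧ (∀ v ∈ A, v ∉ S) ∧ (∀ u ∈ A, ∀ v, G.Adj u v → v ∈ A ∨ v ∈ S) ∧
    ∃ b, b ∉ A ∧ b ∉ S

theorem IsRay.exists_forall_notMem {r : ℕ → V} (hr : IsRay G r) (S : Finset V) :
    ∃ N, ∀ n, N ≤ n → r n ∉ S := by
  have hfin : (r ⁻¹' (S : Set V)).Finite := S.finite_toSet.preimage hr.1.injOn
  obtain ⟨N, hN⟩ := hfin.bddAbove
  refine ⟨N + 1, fun n hn h => ?_⟩
  have : n ≤ N := hN h
  omega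

theorem MoreThanOneEnd.exists_isShore (h : MoreThanOneEnd G) :
    ∃ (S : Finset V) (A : Set V), IsShore G S A := by
  obtain ⟨r, r', hr, hr', hne⟩ := h
  simp only [RayEquiv, not_forall, not_exists] at hne
  obtain ⟨S, hS⟩ := hne
  obtain ⟨N, hN⟩ := hr.exists_forall_notMem S
  obtain ⟨M, hM⟩ := hr'.exists_forall_notMem S
  let A : Set V := {v | Relation.ReflTransGen (fun u v => G.Adj u v ∧ v ∉ S) (r N) v}
  have hA0 : r N ∈ A := Relation.ReflTransGen.refl
  have hAS : ∀ v ∈ A, v ∉ S := by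
    intro v hv
    rcases Relation.ReflTransGen.cases_tail hv with h | ⟨c, -, -, h⟩
    · rw [h]; exact hN N le_rfl
    · exact h
  have hstep : ∀ u ∈ A, ∀ v, G.Adj u v → v ∉ S → v ∈ A := fun u hu v huv hv =>
    Relation.ReflTransGen.tail hu ⟨huv, hv⟩
  have htail : ∀ (q : ℕ → V) (n : ℕ), IsRay G q → (∀ m, n ≤ m → q m ∉ S) → q n ∈ A →
      EventuallyIn q A := by
    intro q n hq hqS hqn
    refine ⟨n, fun m hm => ?_⟩
    induction m, hm using Nat.le_induction with
    | base => exact hqn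
    | succ m hm ih => exact hstep _ ih _ (hq.2 m) (hqS _ (by omega))
  have hconn : (G.induce A).Connected := by
    rw [SimpleGraph.connected_iff_exists_forall_reachable]
    refine ⟨⟨r N, hA0⟩, ?_⟩
    rintro ⟨v, hv⟩
    have hv' : Relation.ReflTransGen (fun u v => G.Adj u v ∧ v ∉ S) (r N) v := hv
    induction hv' with
    | refl => exact SimpleGraph.Reachable.refl _
    | tail h1 h2 ih =>
      refine (ih h1).trans (SimpleGraph.Adj.reachable ?_)
      exact h2.1
  have hcomp : IsCompOf G A {v | v ∉ S} := by
    refine ⟨⟨_, hA0⟩, hAS, hconn, fun C' hC hCS hC' => ?_⟩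
    refine Set.Subset.antisymm (fun v hv => ?_) hC
    have hreach := hC'.preconnected ⟨r N, hC hA0⟩ ⟨v, hv⟩
    rw [SimpleGraph.reachable_iff_reflTransGen] at hreach
    have : ∀ z : C', Relation.ReflTransGen (G.induce C').Adj ⟨r N, hC hA0⟩ z → z.1 ∈ A := by
      intro z hz
      induction hz with
      | refl => exact hA0
      | tail h1 h2 ih => exact hstep _ ih _ h2 (hCS (Subtype.prop _))
    exact this _ hreach
  refine ⟨S, A, ⟨_, hA0⟩, hAS, fun u hu v huv => ?_, r' M, fun hmem => ?_, hM M le_rfl⟩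
  · by_cases hv : v ∈ S
    · exact Or.inr hv
    · exact Or.inl (hstep u hu v huv hv)
  · exact hS A ⟨hcomp, htail r N hr hN hA0, htail r' M hr' hM hmem⟩

theorem MoreThanOneEnd.exists_isSplit (hconn : G.Connected) (h : MoreThanOneEnd G) :
    ∃ (S A B : Set V) (x a b : V), IsSplit G S A B ∧ x ∈ S ∧ a ∈ A ∧ b ∈ B ∧
      G.Adj x a ∧ G.Adj x b := by
  classical
  have hex : ∃ n, ∃ (S : Finset V) (A : Set V), S.card = n ∧ IsShore G S A := by
    obtain ⟨S, A, hSA⟩ := h.exists_isShore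
    exact ⟨_, S, A, rfl, hSA⟩
  obtain ⟨S, A, hc, hne, hAS, hcl, b, hbA, hbS⟩ := Nat.find_spec hex
  have hmin : ∀ (S' : Finset V) (A' : Set V), IsShore G S' A' → S.card ≤ S'.card := by
    intro S' A' h'
    rw [hc]
    exact Nat.find_min' hex ⟨S', A', rfl, h'⟩
  have hSne : S.Nonempty := by
    by_contra hS
    rw [Finset.not_nonempty_iff_eq_empty] at hS
    subst hS
    obtain ⟨a, ha⟩ := hne
    have hreach := hconn.preconnected a b
    rw [SimpleGraph.reachable_iff_reflTransGen] at hreach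
    have : ∀ z, Relation.ReflTransGen G.Adj a z → z ∈ A := by
      intro z hz
      induction hz with
      | refl => exact ha
      | tail h1 h2 ih => exact (hcl _ ih _ h2).resolve_right (by simp)
    exact hbA (this b hreach)
  obtain ⟨x, hx⟩ := hSne
  have hlt : (S.erase x).card < S.card := Finset.card_erase_lt_of_mem hx
  have h1 : ∃ a ∈ A, G.Adj x a := by
    by_contra hno
    push Not at hno
    refine absurd (hmin (S.erase x) A ⟨hne, fun v hv h => hAS v hv (Finset.mem_of_mem_erase h),
      fun u hu v huv => ?_, b, hbA, fun h => hbS (Finset.mem_of_mem_erase h)⟩) (by omega)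
    refine (hcl u hu v huv).imp_right fun hv => Finset.mem_erase.2 ⟨?_, hv⟩
    rintro rfl
    exact hno u hu huv.symm
  have h2 : ∃ b, b ∉ A ∧ b ∉ S ∧ G.Adj x b := by
    by_contra hno
    push Not at hno
    refine absurd (hmin (S.erase x) (insert x A) ⟨⟨x, Set.mem_insert _ _⟩, ?_, ?_, b, ?_,
      fun h => hbS (Finset.mem_of_mem_erase h)⟩) (by omega)
    · rintro v (rfl | hv) h
      · exact Finset.notMem_erase _ _ h
      · exact hAS v hv (Finset.mem_of_mem_erase h)
    · have aux : ∀ v, v ∈ A ∨ v ∈ S → v ∈ insert x A ∨ v ∈ S.erase x := by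
        rintro v (hv | hv)
        · exact Or.inl (Or.inr hv)
        · by_cases hvx : v = x
          · exact Or.inl (Or.inl hvx)
          · exact Or.inr (Finset.mem_erase.2 ⟨hvx, hv⟩)
      rintro u (rfl | hu) v huv
      · refine aux v ?_
        by_contra hcon
        push Not at hcon
        exact hno v hcon.1 hcon.2 huv
      · exact aux v (hcl u hu v huv)
    · rintro (rfl | h)
      · exact hbS hx
      · exact hbA h
  obtain ⟨a, ha, hxa⟩ := h1
  obtain ⟨b', hb1, hb2, hxb⟩ := h2
  refine ⟨S, A, {v | v ∉ A ∧ v ∉ S}, x, a, b', ⟨S.finite_toSet, fun v => ?_, hAS, fun v hv => hv.2,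
    fun v hv hv' => hv'.1 hv, fun u hu v hv huv => ?_⟩, hx, ha, ⟨hb1, hb2⟩, hxa, hxb⟩
  · by_cases h1 : v ∈ S
    · exact Or.inl h1
    · by_cases h2 : v ∈ A
      · exact Or.inr (Or.inl h2)
      · exact Or.inr (Or.inr ⟨h2, h1⟩)
  · exact (hcl u hu v huv).elim hv.1 hv.2

theorem MoreThanOneEnd.infinite (h : MoreThanOneEnd G) : Infinite V := by
  obtain ⟨r, -, hr, -⟩ := h
  exact Infinite.of_injective r hr.1

theorem finite_ball {α : Type*} {G : SimpleGraph α} (hlf : ∀ v, {w | G.Adj v w}.Finite)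
    (x : α) (n : ℕ) : {v | G.Reachable x v ∧ G.dist x v ≤ n}.Finite := by
  induction n with
  | zero =>
    refine (Set.finite_singleton x).subset ?_
    rintro v ⟨hr, hd⟩
    exact (hr.dist_eq_zero_iff.1 (Nat.le_zero.1 hd)).symm
  | succ n ih =>
    refine (ih.union (ih.biUnion fun v _ => hlf v)).subset ?_
    rintro v ⟨hr, hd⟩
    rcases Nat.lt_or_ge n (G.dist x v) with h | h
    · right
      obtain ⟨a, ha, a0, aL⟩ := exists_isGeo hr
      have hd' : G.dist x v = n + 1 := by omega
      rw [hd'] at ha aL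
      refine Set.mem_biUnion (x := a n) ⟨?_, ?_⟩ ?_
      · rw [← a0]; exact ha.reachable (by omega) (by omega)
      · rw [← a0, ha.dist_of_le (by omega) (by omega)]; omega
      · have := ha.1 n (by omega)
        rwa [aL] at this
    · exact Or.inl ⟨hr, h⟩

theorem exists_geo_of_infinite [Infinite V] (hconn : G.Connected)
    (hlf : ∀ v, {w | G.Adj v w}.Finite) (n : ℕ) : ∃ a, IsGeo G n a := by
  obtain ⟨x⟩ := hconn.nonempty
  obtain ⟨v, hv⟩ : ∃ v, n < G.dist x v := by
    by_contra hcon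
    push Not at hcon
    refine Set.infinite_univ ((finite_ball hlf x n).subset fun v _ => ?_)
    exact ⟨hconn.preconnected x v, hcon v⟩
  obtain ⟨a, ha, -⟩ := exists_isGeo (hconn.preconnected x v)
  exact ⟨_, ha.segment (k := 0) (m := n) (by omega)⟩

end Separations

section Shortcut

variable {V : Type u} {E : V → V → Prop}

theorem exists_infinite_of_locally_infinite (hD : IsDigraph E) (hhom : DigraphCHom E)
    (h : ¬ ∀ v, {w | (UG E).Adj v w}.Finite) (x : V) : {w | (UG E).Adj x w}.Infinite := by
  intro hx
  refine h fun v => ?_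
  obtain ⟨ψ, hψ, rfl⟩ := exists_aut_vertex hD hhom x v
  refine (hx.image ψ).subset fun w hw => ⟨ψ.symm w, ?_, by simp⟩
  have hw' : (UG E).Adj (ψ x) (ψ (ψ.symm w)) := by simpa using hw
  exact hψ.ug_adj.1 hw'

theorem HasShortcut.source_of_arc (hD : IsDigraph E) (hhom : DigraphCHom E)
    (htf : ¬ HasTriangle E) (h : HasShortcut E) {x y z : V} (hxy : E x y) (hyz : E y z) :
    ∃ m, E m x ∧ E m z := by
  obtain ⟨a, b, c, d, ab, bc, cd, ad⟩ := h
  obtain ⟨ψ, hψ, rfl, rfl, rfl⟩ := exists_aut_path₃ hD hhom htf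
    (hD.ug_adj.2 (Or.inl bc)) (hD.ug_adj.2 (Or.inl cd)) (fun h => hD.2 _ _ bc (h ▸ cd))
    (hD.ug_adj.2 (Or.inl hxy)) (hD.ug_adj.2 (Or.inl hyz)) (fun h => hD.2 _ _ hxy (h ▸ hyz))
    (iff_of_true bc hxy) (iff_of_true cd hyz)
  exact ⟨ψ a, (hψ _ _).2 ab, (hψ _ _).2 ad⟩

theorem HasShortcut.sink_of_arc (hD : IsDigraph E) (hhom : DigraphCHom E)
    (htf : ¬ HasTriangle E) (h : HasShortcut E) {x y z : V} (hxy : E x y) (hyz : E y z) :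
    ∃ m, E x m ∧ E z m := by
  obtain ⟨a, b, c, d, ab, bc, cd, ad⟩ := h
  obtain ⟨ψ, hψ, rfl, rfl, rfl⟩ := exists_aut_path₃ hD hhom htf
    (hD.ug_adj.2 (Or.inl ab)) (hD.ug_adj.2 (Or.inl bc)) (fun h => hD.2 _ _ ab (h ▸ bc))
    (hD.ug_adj.2 (Or.inl hxy)) (hD.ug_adj.2 (Or.inl hyz)) (fun h => hD.2 _ _ hxy (h ▸ hyz))
    (iff_of_true ab hxy) (iff_of_true bc hyz)
  exact ⟨ψ d, (hψ _ _).2 ad, (hψ _ _).2 cd⟩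

theorem HasShortcut.arc_of_sink (hD : IsDigraph E) (hhom : DigraphCHom E)
    (htf : ¬ HasTriangle E) (h : HasShortcut E) {x y m : V} (hne : x ≠ y)
    (hx : E x m) (hy : E y m) : ∃ c, E x c ∧ E c y := by
  obtain ⟨a, b, c, d, ab, bc, cd, ad⟩ := h
  obtain ⟨ψ, hψ, rfl, rfl, rfl⟩ := exists_aut_path₃ hD hhom htf
    (hD.ug_adj.2 (Or.inl ad)) (hD.ug_adj.2 (Or.inr cd)) (fun h => hD.2 _ _ ab (h ▸ bc))
    (hD.ug_adj.2 (Or.inl hx)) (hD.ug_adj.2 (Or.inr hy)) hne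
    (iff_of_true ad hx) (iff_of_false (hD.2 _ _ cd) (hD.2 _ _ hy))
  exact ⟨ψ b, (hψ _ _).2 ab, (hψ _ _).2 bc⟩

theorem HasShortcut.arc_of_source (hD : IsDigraph E) (hhom : DigraphCHom E)
    (htf : ¬ HasTriangle E) (h : HasShortcut E) {x y m : V} (hne : x ≠ y)
    (hx : E m x) (hy : E m y) : ∃ c, E x c ∧ E c y := by
  obtain ⟨a, b, c, d, ab, bc, cd, ad⟩ := h
  obtain ⟨ψ, hψ, rfl, rfl, rfl⟩ := exists_aut_path₃ hD hhom htf
    (hD.ug_adj.2 (Or.inr ab)) (hD.ug_adj.2 (Or.inl ad)) (fun h => hD.2 _ _ bc (h ▸ cd))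
    (hD.ug_adj.2 (Or.inr hx)) (hD.ug_adj.2 (Or.inl hy)) hne
    (iff_of_false (hD.2 _ _ ab) (hD.2 _ _ hx)) (iff_of_true ad hy)
  exact ⟨ψ c, (hψ _ _).2 bc, (hψ _ _).2 cd⟩

/-- The set of common neighbours. -/
def commonNbrs (E : V → V → Prop) (u v : V) : Set V :=
  {m | (UG E).Adj u m ∧ (UG E).Adj v m}

theorem commonNbrs_comm (u v : V) : commonNbrs E u v = commonNbrs E v u :=
  Set.ext fun _ => and_comm

theorem HasShortcut.arc (hD : IsDigraph E) (hhom : DigraphCHom E)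
    (htf : ¬ HasTriangle E) (h : HasShortcut E) {u v : V} (hne : u ≠ v)
    (hc : (commonNbrs E u v).Nonempty) : ∃ m, E u m ∧ E m v := by
  obtain ⟨m, h1, h2⟩ := hc
  rcases hD.ug_adj.1 h1 with a1 | a1 <;> rcases hD.ug_adj.1 h2 with a2 | a2
  · exact h.arc_of_sink hD hhom htf hne a1 a2
  · exact ⟨m, a1, a2⟩
  · obtain ⟨c, c1, c2⟩ := h.sink_of_arc hD hhom htf a2 a1
    exact h.arc_of_sink hD hhom htf hne c2 c1
  · exact h.arc_of_source hD hhom htf hne a1 a2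

theorem HasShortcut.sink (hD : IsDigraph E) (hhom : DigraphCHom E)
    (htf : ¬ HasTriangle E) (h : HasShortcut E) {u v : V} (hne : u ≠ v)
    (hc : (commonNbrs E u v).Nonempty) : ∃ m, E u m ∧ E v m := by
  obtain ⟨m, h1, h2⟩ := h.arc hD hhom htf hne hc
  exact h.sink_of_arc hD hhom htf h1 h2

theorem HasShortcut.source (hD : IsDigraph E) (hhom : DigraphCHom E)
    (htf : ¬ HasTriangle E) (h : HasShortcut E) {u v : V} (hne : u ≠ v)
    (hc : (commonNbrs E u v).Nonempty) : ∃ m, E m u ∧ E m v := by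
  obtain ⟨m, h1, h2⟩ := h.arc hD hhom htf hne hc
  exact h.source_of_arc hD hhom htf h1 h2

theorem HasShortcut.exists_nbr (hD : IsDigraph E) (hhom : DigraphCHom E)
    (htf : ¬ HasTriangle E) (h : HasShortcut E) {u v : V} (hne : u ≠ v)
    (hc : (commonNbrs E u v).Nonempty) (P : Prop) :
    ∃ m, (E u m ↔ P) ∧ (UG E).Adj u m ∧ (UG E).Adj m v := by
  by_cases hP : P
  · obtain ⟨m, h1, h2⟩ := h.arc hD hhom htf hne hc
    exact ⟨m, iff_of_true h1 hP, hD.ug_adj.2 (Or.inl h1), hD.ug_adj.2 (Or.inl h2)⟩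
  · obtain ⟨m, h1, h2⟩ := h.source hD hhom htf hne hc
    exact ⟨m, iff_of_false (hD.2 _ _ h1) hP, hD.ug_adj.2 (Or.inr h1), hD.ug_adj.2 (Or.inl h2)⟩

theorem HasShortcut.exists_nbr_of_out (hD : IsDigraph E) (hhom : DigraphCHom E)
    (htf : ¬ HasTriangle E) (h : HasShortcut E) {u v : V} (hne : u ≠ v)
    (hc : (commonNbrs E u v).Nonempty) (P : Prop) :
    ∃ m, E u m ∧ (E m v ↔ P) ∧ (UG E).Adj m v := by
  by_cases hP : P
  · obtain ⟨m, h1, h2⟩ := h.arc hD hhom htf hne hc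
    exact ⟨m, h1, iff_of_true h2 hP, hD.ug_adj.2 (Or.inl h2)⟩
  · obtain ⟨m, h1, h2⟩ := h.sink hD hhom htf hne hc
    exact ⟨m, h1, iff_of_false (hD.2 _ _ h2) hP, hD.ug_adj.2 (Or.inr h2)⟩

theorem IsAut.image_commonNbrs {ψ : Equiv.Perm V} (hψ : IsAut E ψ) (u v : V) :
    ψ '' commonNbrs E u v = commonNbrs E (ψ u) (ψ v) := by
  ext m
  constructor
  · rintro ⟨m, ⟨h1, h2⟩, rfl⟩
    exact ⟨hψ.ug_adj.2 h1, hψ.ug_adj.2 h2⟩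
  · rintro ⟨h1, h2⟩
    refine ⟨ψ.symm m, ⟨hψ.ug_adj.1 ?_, hψ.ug_adj.1 ?_⟩, by simp⟩ <;> simpa

theorem HasShortcut.exists_image_eq (hD : IsDigraph E) (hhom : DigraphCHom E)
    (htf : ¬ HasTriangle E) (h : HasShortcut E) {u v u' v' : V} (hne : u ≠ v)
    (hc : (commonNbrs E u v).Nonempty) (hne' : u' ≠ v') (hc' : (commonNbrs E u' v').Nonempty) :
    ∃ ψ : Equiv.Perm V, ψ '' commonNbrs E u v = commonNbrs E u' v' := by
  obtain ⟨m, h1, h2⟩ := h.arc hD hhom htf hne hc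
  obtain ⟨m', h1', h2'⟩ := h.arc hD hhom htf hne' hc'
  obtain ⟨ψ, hψ, rfl, rfl, rfl⟩ := exists_aut_path₃ hD hhom htf
    (hD.ug_adj.2 (Or.inl h1)) (hD.ug_adj.2 (Or.inl h2)) hne
    (hD.ug_adj.2 (Or.inl h1')) (hD.ug_adj.2 (Or.inl h2')) hne'
    (iff_of_true h1 h1') (iff_of_true h2 h2')
  exact ⟨ψ, hψ.image_commonNbrs u v⟩

theorem HasShortcut.ncard_eq (hD : IsDigraph E) (hhom : DigraphCHom E)
    (htf : ¬ HasTriangle E) (h : HasShortcut E) {u v u' v' : V} (hne : u ≠ v)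
    (hc : (commonNbrs E u v).Nonempty) (hne' : u' ≠ v') (hc' : (commonNbrs E u' v').Nonempty) :
    (commonNbrs E u v).ncard = (commonNbrs E u' v').ncard := by
  obtain ⟨ψ, hψ⟩ := h.exists_image_eq hD hhom htf hne hc hne' hc'
  rw [← hψ, Set.ncard_image_of_injective _ ψ.injective]

theorem HasShortcut.finite_iff (hD : IsDigraph E) (hhom : DigraphCHom E)
    (htf : ¬ HasTriangle E) (h : HasShortcut E) {u v u' v' : V} (hne : u ≠ v)
    (hc : (commonNbrs E u v).Nonempty) (hne' : u' ≠ v') (hc' : (commonNbrs E u' v').Nonempty) :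
    (commonNbrs E u v).Finite → (commonNbrs E u' v').Finite := by
  obtain ⟨ψ, hψ⟩ := h.exists_image_eq hD hhom htf hne hc hne' hc'
  rw [← hψ]
  exact Set.Finite.image _

theorem HasShortcut.not_infinite_side (hD : IsDigraph E) (hhom : DigraphCHom E)
    (htf : ¬ HasTriangle E) (h : HasShortcut E) {S A B : Set V} (hS : IsSplit (UG E) S A B)
    {x b : V} (hb : b ∈ B) (hxb : (UG E).Adj x b) :
    ¬ ({y | (UG E).Adj x y} ∩ A).Infinite := by
  intro hinf
  obtain ⟨y, ⟨hy, hyA⟩, y', ⟨hy', hyA'⟩, hne, hf⟩ :=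
    hinf.exists_ne_map_eq_of_mapsTo (f := fun y => ({s ∈ S | E y s}, {s ∈ S | E s y}))
    (t := {T | T ⊆ S} ×ˢ {T | T ⊆ S}) (fun y _ => ⟨Set.sep_subset _ _, Set.sep_subset _ _⟩)
    (hS.finite.finite_subsets.prod hS.finite.finite_subsets)
  have hby : b ≠ y := fun hby => hS.disj y hyA (hby ▸ hb)
  have hsub : commonNbrs E b y ⊆ S := by
    rintro m ⟨m1, m2⟩
    rcases hS.cover m with hm | hm | hm
    · exact hm
    · exact absurd m1.symm (hS.not_adj m hm b hb)
    · exact absurd m2 (hS.not_adj y hyA m hm)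
  obtain ⟨hf1, hf2⟩ := Prod.mk.inj hf
  have f1 : ∀ s ∈ S, E y s → E y' s := by
    intro s hs hys
    have : s ∈ {s ∈ S | E y s} := ⟨hs, hys⟩
    rw [hf1] at this
    exact this.2
  have f2 : ∀ s ∈ S, E s y → E s y' := by
    intro s hs hys
    have : s ∈ {s ∈ S | E s y} := ⟨hs, hys⟩
    rw [hf2] at this
    exact this.2
  have hsub' : commonNbrs E b y ⊆ commonNbrs E y y' := by
    rintro m ⟨m1, m2⟩
    have hm := hsub ⟨m1, m2⟩
    exact ⟨m2, hD.ug_adj.2 ((hD.ug_adj.1 m2).imp (f1 m hm) (f2 m hm))⟩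
  have c1 : (commonNbrs E b y).Nonempty := ⟨x, hxb.symm, SimpleGraph.Adj.symm hy⟩
  have c2 : (commonNbrs E y y').Nonempty := ⟨x, SimpleGraph.Adj.symm hy, SimpleGraph.Adj.symm hy'⟩
  have hfin := h.finite_iff hD hhom htf hby c1 hne c2 (hS.finite.subset hsub)
  have heq := Set.eq_of_subset_of_ncard_le hsub'
    (h.ncard_eq hD hhom htf hne c2 hby c1).le hfin
  obtain ⟨c, hc1, hc2⟩ := h.arc hD hhom htf hne c2
  have hc : c ∈ commonNbrs E b y := by
    rw [heq]
    exact ⟨hD.ug_adj.2 (Or.inl hc1), hD.ug_adj.2 (Or.inr hc2)⟩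
  exact hD.2 _ _ hc2 (f1 c (hsub hc) hc1)

theorem HasShortcut.locallyFinite (hD : IsDigraph E) (hconn : (UG E).Connected)
    (hhom : DigraphCHom E) (htf : ¬ HasTriangle E) (hends : MoreThanOneEnd (UG E))
    (h : HasShortcut E) (v : V) : {w | (UG E).Adj v w}.Finite := by
  by_contra hv
  obtain ⟨S, A, B, x, a, b, hS, -, ha, hb, hxa, hxb⟩ := hends.exists_isSplit hconn
  have hx := exists_infinite_of_locally_infinite hD hhom (fun h => hv (h v)) x
  refine hx (((hS.finite.union (Set.not_infinite.1 (h.not_infinite_side hD hhom htf hS hb hxb))).union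
    (Set.not_infinite.1 (h.not_infinite_side hD hhom htf hS.symm ha hxa))).subset fun y hy => ?_)
  rcases hS.cover y with hy' | hy' | hy'
  · exact Or.inl (Or.inl hy')
  · exact Or.inl (Or.inr ⟨hy, hy'⟩)
  · exact Or.inr ⟨hy, hy'⟩

theorem IsGeo.indPath_ug {n : ℕ} {a : ℕ → V} (ha : IsGeo (UG E) n a) : IndPath E n a := by
  refine ⟨fun i j hi hj hij => ?_, ha.1, fun i j hi hj hij => ?_⟩
  · have := ha.dist_eq hi hj
    rw [hij, SimpleGraph.dist_self] at this
    omega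
  · have := ha.dist_eq hi hj
    rw [SimpleGraph.dist_eq_one_iff_adj.2 hij] at this
    omega

theorem dist_le_two_of_mem_commonNbrs {u v m : V} (h : m ∈ commonNbrs E u v) :
    (UG E).dist u v ≤ 2 := by
  have := h.1.reachable.dist_triangle_left v
  rw [SimpleGraph.dist_eq_one_iff_adj.2 h.1, SimpleGraph.dist_eq_one_iff_adj.2 h.2.symm] at this
  exact this

theorem HasShortcut.adj_of_dist_three (hD : IsDigraph E)
    (hhom : DigraphCHom E) (htf : ¬ HasTriangle E) (h : HasShortcut E) {a : ℕ → V}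
    (ha : IsGeo (UG E) 4 a) {p q u w : V} (hpq : (UG E).dist p q = 3) (hpu : (UG E).Adj p u)
    (huq : (commonNbrs E u q).Nonempty) (hqw : (UG E).Adj q w)
    (hpw : (commonNbrs E p w).Nonempty) : (UG E).Adj u w := by
  by_contra huw
  have npq : ¬ (UG E).Adj p q := fun hadj => by
    rw [SimpleGraph.dist_eq_one_iff_adj.2 hadj] at hpq
    omega
  have nuq : u ≠ q := by rintro rfl; exact npq hpu
  have npw' : ¬ (UG E).Adj p w := fun hadj => by
    have := dist_le_two_of_mem_commonNbrs (E := E) (u := p) (v := q) ⟨hadj, hqw⟩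
    omega
  have npw : p ≠ w := by rintro rfl; exact npq hqw.symm
  obtain ⟨x, hux, hxq⟩ := h.arc hD hhom htf nuq huq
  have i1 := indPath_path₅ htf hpu (hD.ug_adj.2 (Or.inl hux)) (hD.ug_adj.2 (Or.inl hxq)) hqw
    (by rintro rfl; exact npq (hD.ug_adj.2 (Or.inl hxq))) nuq
    (by rintro rfl; exact huw (hD.ug_adj.2 (Or.inl hux))) npw npq huw npw'
  have d02 := ha.dist_eq (i := 0) (j := 2) (by omega) (by omega)
  have d03 := ha.dist_eq (i := 0) (j := 3) (by omega) (by omega)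
  have d04 := ha.2
  obtain ⟨b1, hb1, hb2, hb3⟩ := h.exists_nbr hD hhom htf (u := a 0) (v := a 2)
    (by intro hh; rw [hh, SimpleGraph.dist_self] at d02; omega)
    ⟨a 1, ha.1 0 (by omega), (ha.1 1 (by omega)).symm⟩ (E p u)
  obtain ⟨b2, hb4, hb5⟩ := h.arc hD hhom htf (u := b1) (v := a 3)
    (by rintro rfl; rw [SimpleGraph.dist_eq_one_iff_adj.2 hb2] at d03; omega)
    ⟨a 2, hb3, (ha.1 2 (by omega)).symm⟩
  have hb4' : (UG E).Adj b1 b2 := hD.ug_adj.2 (Or.inl hb4)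
  obtain ⟨b3, hb6, hb7, hb8⟩ := h.exists_nbr_of_out hD hhom htf (u := b2) (v := a 4)
    (by
      rintro rfl
      have := dist_le_two_of_mem_commonNbrs (E := E) (u := a 0) (v := a 4) ⟨hb2, hb4'.symm⟩
      omega)
    ⟨a 3, hD.ug_adj.2 (Or.inl hb5), (ha.1 3 (by omega)).symm⟩ (E q w)
  have i2 : IsGeo (UG E) 4 (listSeq [a 0, b1, b2, b3, a 4] (a 0)) := by
    refine ⟨fun i hi => ?_, d04⟩
    interval_cases i
    · exact hb2
    · exact hb4'
    · exact hD.ug_adj.2 (Or.inl hb6)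
    · exact hb8
  obtain ⟨ψ, hψ, hm⟩ := IndPath.exists_aut hD hhom i1 i2.indPath_ug (by
    intro i hi
    interval_cases i
    · exact hb1.symm
    · exact iff_of_true hux hb4
    · exact iff_of_true hxq hb6
    · exact hb7.symm)
  have m0 : ψ p = a 0 := hm 0 (by omega)
  have m4 : ψ w = a 4 := hm 4 (by omega)
  have hd : (UG E).dist (ψ p) (ψ w) = (UG E).dist p w := dist_eq_of_iso hψ.ugIso p w
  obtain ⟨m, hm⟩ := hpw
  have := dist_le_two_of_mem_commonNbrs hm
  rw [m0, m4, d04] at hd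
  omega

theorem not_hasShortcut (hD : IsDigraph E) (hconn : (UG E).Connected)
    (hhom : DigraphCHom E) (htf : ¬ HasTriangle E) (hends : MoreThanOneEnd (UG E)) :
    ¬ HasShortcut E := by
  intro h
  have hlf := h.locallyFinite hD hconn hhom htf hends
  have := hends.infinite
  obtain ⟨a, ha⟩ := exists_geo_of_infinite hconn hlf 4
  have d02 := ha.dist_eq (i := 0) (j := 2) (by omega) (by omega)
  have d03 := ha.dist_eq (i := 0) (j := 3) (by omega) (by omega)
  have n02 : a 0 ≠ a 2 := by intro hh; rw [hh, SimpleGraph.dist_self] at d02; omega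
  have n03 : ¬ (UG E).Adj (a 0) (a 3) := by
    intro hh; rw [SimpleGraph.dist_eq_one_iff_adj.2 hh] at d03; omega
  have c02 : (commonNbrs E (a 0) (a 2)).Nonempty :=
    ⟨a 1, ha.1 0 (by omega), (ha.1 1 (by omega)).symm⟩
  obtain ⟨u, hu1, hu2⟩ := h.arc hD hhom htf n02 c02
  obtain ⟨u', hu1', hu2'⟩ := h.arc hD hhom htf n02.symm (by rwa [commonNbrs_comm])
  have a0u : (UG E).Adj (a 0) u := hD.ug_adj.2 (Or.inl hu1)
  have a0u' : (UG E).Adj (a 0) u' := hD.ug_adj.2 (Or.inr hu2')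
  have huu : u ≠ u' := by rintro rfl; exact hD.2 _ _ hu1 hu2'
  have huq : u ≠ a 3 := by rintro hh; exact n03 (hh ▸ a0u)
  have hmem : a 2 ∈ commonNbrs E u (a 3) :=
    ⟨hD.ug_adj.2 (Or.inl hu2), (ha.1 2 (by omega)).symm⟩
  have hmem' : a 2 ∈ commonNbrs E u' (a 3) :=
    ⟨hD.ug_adj.2 (Or.inr hu1'), (ha.1 2 (by omega)).symm⟩
  have hss : commonNbrs E u (a 3) ⊂ commonNbrs E u u' := by
    refine ⟨fun c hc => ⟨hc.1, ?_⟩, fun hsub => ?_⟩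
    · exact h.adj_of_dist_three hD hhom htf ha d03 a0u' ⟨_, hmem'⟩ hc.2
        ⟨u, a0u, hc.1.symm⟩
    · exact n03 (hsub ⟨a0u.symm, a0u'.symm⟩).2.symm
  have hlt := Set.ncard_lt_ncard hss ((hlf u).subset fun m hm => hm.1)
  have := h.ncard_eq hD hhom htf huq ⟨_, hmem⟩ huu ⟨a 0, a0u.symm, a0u'.symm⟩
  omega

end Shortcut

section FourCyclic

variable {V : Type u} {E : V → V → Prop}

/-- Every directed path of length two lies on a directed 4-cycle. -/
def FourCyclic (E : V → V → Prop) : Prop :=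
  ∀ x y z, E x y → E y z → ∃ d, E z d ∧ E d x

theorem FourCyclic.flip (h : FourCyclic E) : FourCyclic (fun x y => E y x) := by
  intro x y z hxy hyz
  obtain ⟨d, h1, h2⟩ := h z y x hyz hxy
  exact ⟨d, h2, h1⟩

theorem IsMinBackGeo.fourCyclic (hD : IsDigraph E) (hhom : DigraphCHom E)
    (htf : ¬ HasTriangle E) {L : ℕ} {a : ℕ → V × Bool} (h : IsMinBackGeo E L a) :
    FourCyclic E := by
  intro x y z hxy hyz
  obtain ⟨x', y', z', d, h1, h2, h3, h4⟩ := h.exists_four_cycle hD hhom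
  obtain ⟨ψ, hψ, rfl, rfl, rfl⟩ := exists_aut_path₃ hD hhom htf
    (hD.ug_adj.2 (Or.inl h1)) (hD.ug_adj.2 (Or.inl h2)) (fun h => hD.2 _ _ h1 (h ▸ h2))
    (hD.ug_adj.2 (Or.inl hxy)) (hD.ug_adj.2 (Or.inl hyz)) (fun h => hD.2 _ _ hxy (h ▸ hyz))
    (iff_of_true h1 hxy) (iff_of_true h2 hyz)
  exact ⟨ψ d, (hψ _ _).2 h3, (hψ _ _).2 h4⟩

theorem IsMinBackGeo.not_isGeo_succ (hD : IsDigraph E) (hhom : DigraphCHom E)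
    (htf : ¬ HasTriangle E) (hns : ¬ HasShortcut E) {L : ℕ} {a b : ℕ → V × Bool}
    (h : IsMinBackGeo E L a) (hb0 : (b 0).2 = true) : ¬ IsGeo (altGraph E) (L + 1) b := by
  intro hb
  have hL := h.two_le
  have hseg : ∀ {c : ℕ → V × Bool} {n : ℕ}, IsGeo (altGraph E) n c → L - 1 ≤ n →
      IsGeo (altGraph E) (L - 1) c := by
    intro c n hc hn
    have := hc.segment (k := 0) (m := L - 1) (by omega)
    simpa only [Nat.zero_add] using this
  have ha' := hseg h.geo (by omega)
  have hb' := hseg hb (by omega)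
  obtain ⟨ψ, hψ, hm⟩ := h.exists_aut hD hhom ha' hb' (by rw [h.snd_zero, hb0])
  have aA := h.geo.1 (L - 1) (by omega)
  have bA := hb.1 (L - 1) (by omega)
  have bA' := hb.1 (L - 2) (by omega)
  rw [show L - 1 + 1 = L by omega] at aA bA
  rw [show L - 2 + 1 = L - 1 by omega] at bA'
  have bA'' := hb.1 L (by omega)
  have sa : (a (L - 1)).2 = true := by
    have := altGraph_adj_snd aA
    rw [h.snd_last] at this
    simpa using this.symm
  have sb : (b (L - 1)).2 = true := by rw [← ha'.snd_eq hb' (by rw [h.snd_zero, hb0]) _ le_rfl, sa]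
  have sbL : (b L).2 = false := by rw [altGraph_adj_snd bA, sb]; rfl
  have sbL1 : (b (L + 1)).2 = true := by rw [altGraph_adj_snd bA'', sbL]; rfl
  have sb2 : (b (L - 2)).2 = false := by
    have := altGraph_adj_snd bA'
    rw [sb] at this
    simpa using this.symm
  have eaL : E (a (L - 1)).1 (a L).1 := (altGraph_adj_edge hD aA).2 sa
  have qr := (hψ _ _).2 eaL
  have rp := (hψ _ _).2 h.back
  rw [hm (L - 1) le_rfl] at qr
  rw [hm 0 (by omega)] at rp
  have qu : E (b (L - 1)).1 (b L).1 := (altGraph_adj_edge hD bA).2 sb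
  have qp : E (b (L - 1)).1 (b (L - 2)).1 := (altGraph_adj_edge hD bA'.symm).2 sb
  have wu : E (b (L + 1)).1 (b L).1 := (altGraph_adj_edge hD bA''.symm).2 sbL1
  have pair : ∀ {x : V × Bool} {c : Bool}, x.2 = c → x = (x.1, c) := fun hc => Prod.ext rfl hc
  have d0 := hb.dist_eq (i := 0) (j := L) (by omega) (by omega)
  have d1 := hb.dist_eq (i := 0) (j := L + 1) (by omega) le_rfl
  have d2 := hb.dist_eq (i := 0) (j := L - 2) (by omega) (by omega)
  have r2 := hb.reachable (i := 0) (j := L - 2) (by omega) (by omega)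
  rw [pair hb0, pair sbL] at d0
  rw [pair hb0, pair sbL1] at d1
  rw [pair hb0, pair sb2] at d2 r2
  have ad : ∀ {x y}, E x y → (UG E).Adj x y := fun h => hD.ug_adj.2 (Or.inl h)
  have ad' : ∀ {x y}, E y x → (UG E).Adj x y := fun h => hD.ug_adj.2 (Or.inr h)
  by_cases hup : E (b L).1 (b 0).1
  · obtain ⟨χ, hχ, c1, -, c3⟩ := exists_aut_path₃ hD hhom htf
      (ad eaL) (ad h.back) (fun hh => hD.2 _ _ eaL (hh ▸ h.back))
      (ad wu) (ad hup) (fun hh => hD.2 _ _ wu (hh ▸ hup))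
      (iff_of_true eaL wu) (iff_of_true h.back hup)
    have := hχ.altGraph_dist (a 0).1 (a (L - 1)).1 true true
    rw [c1, c3, d1, ← pair h.snd_zero, ← pair sa, h.geo.dist_eq (by omega) (by omega)] at this
    omega
  · have npu : ¬ E (b 0).1 (b L).1 := fun hh => hns ⟨_, _, _, _, qr, rp, hh, qu⟩
    have npp : ¬ E (b 0).1 (b (L - 2)).1 := fun hh => hns ⟨_, _, _, _, qr, rp, hh, qp⟩
    have npp' : ¬ E (b (L - 2)).1 (b 0).1 := fun hh => by
      have := h.le_dist _ _ hh r2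
      omega
    have n1 : (b 0).1 ≠ (b (L - 1)).1 := fun hh => hD.2 _ _ rp (hh ▸ qr)
    obtain ⟨χ, hχ, c1, -, -, c4⟩ := exists_aut_path₄ hD hhom htf
      (ad' rp) (ad' qr) (ad qu) n1 (fun hh => hup (hh ▸ rp))
      (fun hh => (hD.ug_adj.1 hh).elim npu hup)
      (ad' rp) (ad' qr) (ad qp) n1 (fun hh => npp' (hh ▸ rp))
      (fun hh => (hD.ug_adj.1 hh).elim npp npp')
      Iff.rfl Iff.rfl (iff_of_true qu qp)
    have := hχ.altGraph_dist (b 0).1 (b L).1 true false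
    rw [c1, c4, d0, d2] at this
    omega

theorem IsMinBackGeo.not_locallyFinite (hD : IsDigraph E) (hconn : (UG E).Connected)
    (hhom : DigraphCHom E) (htf : ¬ HasTriangle E) [Infinite V] (hns : ¬ HasShortcut E) {L : ℕ}
    {a : ℕ → V × Bool} (h : IsMinBackGeo E L a) : ¬ ∀ v, {w | (UG E).Adj v w}.Finite := by
  intro hlf
  have hlf' : ∀ z, {c | (altGraph E).Adj z c}.Finite := by
    intro z
    refine ((hlf z.1).prod (Set.toFinite (Set.univ : Set Bool))).subset fun c hc => ?_
    exact ⟨altGraph_adj_ug hD hc, Set.mem_univ _⟩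
  have hback : ∀ x y, E x y → (altGraph E).Reachable (y, true) (x, false) := by
    intro x y hxy
    obtain ⟨ψ, hψ, rfl, rfl⟩ := exists_aut_edge hD hhom h.back hxy
    rw [hψ.altGraph_reachable]
    have := h.geo.reachable (i := 0) (j := L) (by omega) le_rfl
    have e0 : a 0 = ((a 0).1, true) := Prod.ext rfl h.snd_zero
    have eL : a L = ((a L).1, false) := Prod.ext rfl h.snd_last
    rwa [e0, eL] at this
  obtain ⟨o⟩ := hconn.nonempty
  have hcl : ∀ x y, (UG E).Adj x y → ∀ b, ∃ c, (altGraph E).Reachable (x, b) (y, c) := by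
    intro x y hxy b
    rcases hD.ug_adj.1 hxy with hE | hE <;> cases b
    · exact ⟨true, (hback x y hE).symm⟩
    · exact ⟨false, (altGraph_adj_true.2 ⟨rfl, hE⟩ : (altGraph E).Adj _ _).reachable⟩
    · exact ⟨true, (altGraph_adj_false.2 ⟨rfl, hE⟩ : (altGraph E).Adj _ _).reachable⟩
    · exact ⟨false, hback y x hE⟩
  have hall : ∀ v, ∃ c, (altGraph E).Reachable (o, true) (v, c) := by
    intro v
    have := hconn.preconnected o v
    rw [SimpleGraph.reachable_iff_reflTransGen] at this
    induction this with
    | refl => exact ⟨true, SimpleGraph.Reachable.refl _⟩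
    | tail _ h2 ih =>
      obtain ⟨c, hc⟩ := ih
      obtain ⟨c', hc'⟩ := hcl _ _ h2 c
      exact ⟨c', hc.trans hc'⟩
  refine Set.infinite_univ (((finite_ball hlf' (o, true) L).image Prod.fst).subset fun v _ => ?_)
  obtain ⟨c, hc⟩ := hall v
  refine ⟨(v, c), ⟨hc, ?_⟩, rfl⟩
  by_contra hlt
  obtain ⟨b, hb, hb0, -⟩ := exists_isGeo hc
  have hb' := hb.segment (k := 0) (m := L + 1) (by omega)
  simp only [Nat.zero_add] at hb'
  exact h.not_isGeo_succ hD hhom htf hns (by rw [hb0]) hb'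

theorem FourCyclic.infinite_in (hD : IsDigraph E) (hhom : DigraphCHom E) (h4 : FourCyclic E)
    (hinf : ¬ ∀ v, {w | (UG E).Adj v w}.Finite) (v : V) : {w | E w v}.Infinite := by
  intro hv
  have hin : ∀ v, {w | E w v}.Finite := by
    intro v'
    obtain ⟨ψ, hψ, rfl⟩ := exists_aut_vertex hD hhom v v'
    refine (hv.image ψ).subset fun w hw => ⟨ψ.symm w, ?_, by simp⟩
    have hw' : E (ψ (ψ.symm w)) (ψ v) := by simpa using hw
    exact (hψ _ _).1 hw'
  refine hinf fun x => ?_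
  have hout : {y | E x y}.Finite := by
    by_contra hx
    obtain ⟨y, hy⟩ := Set.Infinite.nonempty hx
    obtain ⟨ψ, hψ, hψy⟩ := exists_aut_vertex hD hhom y x
    have hw := (hψ _ _).2 (show E x y from hy)
    rw [hψy] at hw
    refine hx (((hin (ψ x)).biUnion fun m _ => hin m).subset fun y hy => ?_)
    obtain ⟨d, d1, d2⟩ := h4 _ _ _ hw hy
    exact Set.mem_biUnion (x := d) d2 d1
  exact (hout.union (hin x)).subset fun w hw => hD.ug_adj.1 hw

theorem exists_separated_arc (hD : IsDigraph E) (hconn : (UG E).Connected)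
    (hends : MoreThanOneEnd (UG E)) (hin : ∀ v, {w | E w v}.Infinite)
    (hout : ∀ v, {w | E v w}.Infinite) :
    ∃ (S A B : Set V) (z x y : V), IsSplit (UG E) S A B ∧ z ∈ A ∧ y ∈ B ∧ E z x ∧ E x y := by
  obtain ⟨S, A, B, x, a, b, hS, -, ha, hb, hxa, hxb⟩ := hends.exists_isSplit hconn
  obtain ⟨z, hz, hzS⟩ := (hin x).exists_notMem_finite hS.finite
  obtain ⟨y, hy, hyS⟩ := (hout x).exists_notMem_finite hS.finite
  rcases (hS.cover z).resolve_left hzS with hzA | hzB <;>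
    rcases (hS.cover y).resolve_left hyS with hyA | hyB
  · rcases hD.ug_adj.1 hxb with h | h
    · exact ⟨S, A, B, z, x, b, hS, hzA, hb, hz, h⟩
    · exact ⟨S, B, A, b, x, y, hS.symm, hb, hyA, h, hy⟩
  · exact ⟨S, A, B, z, x, y, hS, hzA, hyB, hz, hy⟩
  · exact ⟨S, B, A, z, x, y, hS.symm, hzB, hyA, hz, hy⟩
  · rcases hD.ug_adj.1 hxa with h | h
    · exact ⟨S, B, A, z, x, a, hS.symm, hzB, ha, hz, h⟩
    · exact ⟨S, A, B, a, x, y, hS, ha, hyB, h, hy⟩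

theorem FourCyclic.finite_out_side (hD : IsDigraph E) (h4 : FourCyclic E)
    (hF : ∀ x z, {m | E x m ∧ E m z}.Finite) {S A B : Set V} (hS : IsSplit (UG E) S A B)
    {z x : V} (hz : z ∈ A) (hzx : E z x) : {y | E x y ∧ y ∈ B}.Finite := by
  refine (hS.finite.biUnion fun d _ => hF x d).subset ?_
  rintro y ⟨hy, hyB⟩
  obtain ⟨d, d1, d2⟩ := h4 _ _ _ hzx hy
  rcases hS.cover d with h | h | h
  · exact Set.mem_biUnion h ⟨hy, d1⟩
  · exact absurd (hD.ug_adj.2 (Or.inr d1)) (hS.not_adj d h y hyB)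
  · exact absurd (hD.ug_adj.2 (Or.inr d2)) (hS.not_adj z hz d h)

theorem FourCyclic.locallyFinite (hD : IsDigraph E) (hconn : (UG E).Connected)
    (hhom : DigraphCHom E) (htf : ¬ HasTriangle E) (hends : MoreThanOneEnd (UG E))
    (h4 : FourCyclic E) (v : V) : {w | (UG E).Adj v w}.Finite := by
  by_contra hv
  have hinf : ¬ ∀ v, {w | (UG E).Adj v w}.Finite := fun h => hv (h v)
  have hin := h4.infinite_in hD hhom hinf
  have hout : ∀ v, {w | E v w}.Infinite :=
    h4.flip.infinite_in hD.flip hhom.flip (by rwa [ug_flip])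
  obtain ⟨S, A, B, z, x, y, hS, hz, hy, hzx, hxy⟩ := exists_separated_arc hD hconn hends hin hout
  have hF0 : {m | E z m ∧ E m y}.Finite := by
    refine hS.finite.subset ?_
    rintro m ⟨m1, m2⟩
    rcases hS.cover m with h | h | h
    · exact h
    · exact absurd (hD.ug_adj.2 (Or.inl m2)) (hS.not_adj m h y hy)
    · exact absurd (hD.ug_adj.2 (Or.inl m1)) (hS.not_adj z hz m h)
  have hF : ∀ x z, {m | E x m ∧ E m z}.Finite := by
    intro x' z'
    rcases Set.eq_empty_or_nonempty {m | E x' m ∧ E m z'} with h | ⟨m, m1, m2⟩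
    · rw [h]; exact Set.finite_empty
    · obtain ⟨ψ, hψ, rfl, rfl, rfl⟩ := exists_aut_path₃ hD hhom htf
        (hD.ug_adj.2 (Or.inl hzx)) (hD.ug_adj.2 (Or.inl hxy)) (fun h => hD.2 _ _ hzx (h ▸ hxy))
        (hD.ug_adj.2 (Or.inl m1)) (hD.ug_adj.2 (Or.inl m2)) (fun h => hD.2 _ _ m1 (h ▸ m2))
        (iff_of_true hzx m1) (iff_of_true hxy m2)
      refine (hF0.image ψ).subset ?_
      rintro n ⟨n1, n2⟩
      refine ⟨ψ.symm n, ⟨(hψ _ _).1 ?_, (hψ _ _).1 ?_⟩, by simp⟩ <;> simpa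
  have hinA : ∀ n, E n x → n ∉ B := by
    intro n hn hnB
    have f1 := h4.finite_out_side hD hF hS hz hzx
    have f2 := h4.finite_out_side hD hF hS.symm hnB hn
    refine hout x (((hS.finite.union f2).union f1).subset fun w hw => ?_)
    rcases hS.cover w with h | h | h
    · exact Or.inl (Or.inl h)
    · exact Or.inl (Or.inr ⟨hw, h⟩)
    · exact Or.inr ⟨hw, h⟩
  refine hout y ((hS.finite.union (hS.finite.biUnion fun n _ => hF y n)).subset fun m hm => ?_)
  by_cases hmS : m ∈ S
  · exact Or.inl hmS
  right
  have hmB : m ∈ B := ((hS.cover m).resolve_left hmS).resolve_left fun hmA =>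
    hS.not_adj m hmA y hy (hD.ug_adj.2 (Or.inr hm))
  obtain ⟨n, n1, n2⟩ := h4 _ _ _ hxy hm
  rcases hS.cover n with h | h | h
  · exact Set.mem_biUnion h ⟨hm, n1⟩
  · exact absurd (hD.ug_adj.2 (Or.inr n1)) (hS.not_adj n h m hmB)
  · exact absurd h (hinA n n2)

theorem altSeparated (hD : IsDigraph E) (hconn : (UG E).Connected)
    (hhom : DigraphCHom E) (htf : ¬ HasTriangle E) (hends : MoreThanOneEnd (UG E)) :
    AltSeparated E := by
  have hns := not_hasShortcut hD hconn hhom htf hends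
  have := hends.infinite
  rcases altSeparated_or hD hhom with h | h | ⟨L, a, h⟩
  · exact h
  · exact absurd h hns
  · exact absurd ((h.fourCyclic hD hhom htf).locallyFinite hD hconn hhom htf hends)
      (h.not_locallyFinite hD hconn hhom htf hns)

end FourCyclic

section Reachability

variable {V : Type u} {E : V → V → Prop}

theorem IsAltWalk.reachable_tail (hD : IsDigraph E) {n : ℕ} {w : ℕ → V} (hw : IsAltWalk E n w) :
    ∃ t : ℕ → V, (∀ i < n, ∀ e : V × V, E e.1 e.2 →
      ((w i = e.1 ∧ w (i + 1) = e.2) ∨ (w i = e.2 ∧ w (i + 1) = e.1)) → t i = e.1) ∧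
      ∀ i < n, (altGraph E).Reachable (t 0, true) (t i, true) := by
  classical
  refine ⟨fun i => if E (w i) (w (i + 1)) then w i else w (i + 1), ?_, ?_⟩
  · rintro i - ⟨x, y⟩ hxy (⟨h1, h2⟩ | ⟨h1, h2⟩)
    · simp only [h1, h2] at hxy ⊢
      rw [if_pos hxy]
    · simp only [h1, h2] at hxy ⊢
      rw [if_neg (hD.2 _ _ hxy)]
  · intro i
    induction i with
    | zero => intro _; exact SimpleGraph.Reachable.refl _
    | succ k ih =>
      intro hk
      refine (ih (by omega)).trans ?_
      have h1 := hw.1 k (by omega)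
      have h2 := hw.1 (k + 1) hk
      have h3 := hw.2 k (by omega)
      by_cases hE : E (w k) (w (k + 1))
      · have hE' := h3.1 hE
        simp only [if_pos hE, if_neg (hD.2 _ _ hE')]
        have a1 : (altGraph E).Adj (w k, true) (w (k + 1), false) :=
          altGraph_adj_true.2 ⟨rfl, hE⟩
        have a2 : (altGraph E).Adj (w (k + 1), false) (w (k + 1 + 1), true) :=
          altGraph_adj_false.2 ⟨rfl, hE'⟩
        exact a1.reachable.trans a2.reachable
      · have hE' : E (w (k + 1)) (w (k + 1 + 1)) := h2.resolve_right fun h => hE (h3.2 h)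
        simp only [if_neg hE, if_pos hE']
        exact SimpleGraph.Reachable.refl _

theorem isAltWalk_of_altGraph (hD : IsDigraph E) {n : ℕ} {a : ℕ → V × Bool}
    (ha : ∀ i < n, (altGraph E).Adj (a i) (a (i + 1))) : IsAltWalk E n (fun i => (a i).1) := by
  refine ⟨fun i hi => hD.ug_adj.1 (altGraph_adj_ug hD (ha i hi)), fun i hi => ?_⟩
  have h1 := ha i (by omega)
  have h2 := ha (i + 1) (by omega)
  rw [altGraph_adj_edge hD h1, altGraph_adj_edge hD h2.symm, altGraph_adj_snd h2,
    altGraph_adj_snd h1, Bool.not_not]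

theorem reach_iff (hD : IsDigraph E) {e : V × V} (he : E e.1 e.2) {x y : V} (hxy : E x y) :
    Reach E e (x, y) ↔ (altGraph E).Reachable (e.1, true) (x, true) := by
  constructor
  · rintro ⟨n, w, hw, ⟨i, hi, hi'⟩, j, hj, hj'⟩
    obtain ⟨t, ht, hr⟩ := hw.reachable_tail hD
    have h1 := hr i hi
    have h2 := hr j hj
    rw [ht i hi e he hi'] at h1
    rw [ht j hj (x, y) hxy hj'] at h2
    exact h1.symm.trans h2
  · rintro ⟨p⟩
    have h1 : (altGraph E).Adj (e.2, false) (e.1, true) := altGraph_adj_false.2 ⟨rfl, he⟩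
    have h2 : (altGraph E).Adj (x, true) (y, false) := altGraph_adj_true.2 ⟨rfl, hxy⟩
    let W := SimpleGraph.Walk.cons h1 (p.concat h2)
    have hlen : W.length = p.length + 2 := by simp [W]
    have hpen : W.getVert (p.length + 1) = (x, true) := by
      have := p.penultimate_concat h2
      simpa [W, SimpleGraph.Walk.penultimate] using this
    have hlast : W.getVert (p.length + 1 + 1) = (y, false) := by
      rw [← hlen]; exact W.getVert_length
    refine ⟨W.length, _, isAltWalk_of_altGraph hD (a := W.getVert) fun i hi => W.adj_getVert_succ hi,
      ⟨0, by omega, Or.inr ⟨by simp, by simp [W]⟩⟩, ⟨p.length + 1, by omega, Or.inl ⟨?_, ?_⟩⟩⟩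
    · exact congrArg Prod.fst hpen
    · exact congrArg Prod.fst hlast

theorem deltaRel_iff (hD : IsDigraph E) {e : V × V} (he : E e.1 e.2) {x y : V} :
    DeltaRel E e x y ↔ E x y ∧ (altGraph E).Reachable (e.1, true) (x, true) :=
  and_congr_right fun h => reach_iff hD he h

theorem IsDigraph.deltaRel (hD : IsDigraph E) (e : V × V) : IsDigraph (DeltaRel E e) :=
  ⟨fun x h => hD.1 x h.1, fun x y h h' => hD.2 x y h.1 h'.1⟩

theorem deltaGraph_adj (hD : IsDigraph E) {e : V × V} {x y : V} :
    (DeltaGraph E e).Adj x y ↔ DeltaRel E e x y ∨ DeltaRel E e y x :=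
  (hD.deltaRel e).ug_adj

theorem mem_tails_iff (hD : IsDigraph E) (hhom : DigraphCHom E) {e : V × V} (he : E e.1 e.2)
    {x : V} : x ∈ Tails E e ↔ (altGraph E).Reachable (e.1, true) (x, true) := by
  constructor
  · rintro ⟨y, hy⟩
    exact ((deltaRel_iff hD he).1 hy).2
  · intro h
    obtain ⟨ψ, hψ, rfl⟩ := exists_aut_vertex hD hhom e.1 x
    exact ⟨ψ e.2, (deltaRel_iff hD he).2 ⟨(hψ _ _).2 he, h⟩⟩

theorem mem_heads_iff (hD : IsDigraph E) (hhom : DigraphCHom E) {e : V × V} (he : E e.1 e.2)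
    {y : V} : y ∈ Heads E e ↔ (altGraph E).Reachable (e.1, true) (y, false) := by
  constructor
  · rintro ⟨x, hx⟩
    obtain ⟨h1, h2⟩ := (deltaRel_iff hD he).1 hx
    have h3 : (altGraph E).Adj (x, true) (y, false) := altGraph_adj_true.2 ⟨rfl, h1⟩
    exact h2.trans h3.reachable
  · intro h
    obtain ⟨ψ, hψ, rfl⟩ := exists_aut_vertex hD hhom e.2 y
    have h3 : (altGraph E).Adj (ψ e.2, false) (ψ e.1, true) :=
      altGraph_adj_false.2 ⟨rfl, (hψ _ _).2 he⟩
    exact ⟨ψ e.1, (deltaRel_iff hD he).2 ⟨(hψ _ _).2 he, h.trans h3.reachable⟩⟩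

theorem AltSeparated.disjoint (hD : IsDigraph E) (hhom : DigraphCHom E) (hs : AltSeparated E)
    {e : V × V} (he : E e.1 e.2) {x : V} (hT : x ∈ Tails E e) : x ∉ Heads E e := fun hH =>
  hs.1 x (((mem_tails_iff hD hhom he).1 hT).symm.trans ((mem_heads_iff hD hhom he).1 hH))

theorem AltSeparated.edge_iff (hD : IsDigraph E) (hhom : DigraphCHom E) (hs : AltSeparated E)
    {e : V × V} (he : E e.1 e.2) {x y : V} (hx : x ∈ Tails E e ∪ Heads E e)
    (hy : y ∈ Tails E e ∪ Heads E e) :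
    E x y ↔ (DeltaGraph E e).Adj x y ∧ x ∈ Tails E e := by
  rw [deltaGraph_adj hD]
  constructor
  · intro hxy
    suffices hT : x ∈ Tails E e from
      ⟨Or.inl ((deltaRel_iff hD he).2 ⟨hxy, (mem_tails_iff hD hhom he).1 hT⟩), hT⟩
    rcases hx with hx | hx
    · exact hx
    rw [mem_heads_iff hD hhom he] at hx
    rcases hy with hy | hy
    · rw [mem_tails_iff hD hhom he] at hy
      exact absurd (hy.symm.trans hx) (hs.2 y x hxy)
    · rw [mem_heads_iff hD hhom he] at hy
      have h3 : (altGraph E).Adj (y, false) (x, true) := altGraph_adj_false.2 ⟨rfl, hxy⟩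
      exact (mem_tails_iff hD hhom he).2 (hy.trans h3.reachable)
  · rintro ⟨h | h, hT⟩
    · exact h.1
    · exact absurd ⟨y, h⟩ (hs.disjoint hD hhom he hT)

theorem AltSeparated.isBipartition (hD : IsDigraph E) (hhom : DigraphCHom E)
    (hs : AltSeparated E) {e : V × V} (he : E e.1 e.2) :
    IsBipartition ((DeltaGraph E e).induce (Tails E e ∪ Heads E e))
      {v | v.1 ∈ Tails E e} {v | v.1 ∈ Heads E e} := by
  refine ⟨Set.eq_univ_of_forall fun v => v.2, ?_, fun a b hab => ?_⟩
  · rw [Set.disjoint_left]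
    exact fun v hT => hs.disjoint hD hhom he hT
  · have hab' : (DeltaGraph E e).Adj a.1 b.1 := hab
    rcases (deltaGraph_adj hD).1 hab' with h | h
    · exact Or.inl ⟨⟨_, h⟩, ⟨_, h⟩⟩
    · exact Or.inr ⟨⟨_, h⟩, ⟨_, h⟩⟩

theorem deltaGraph_connected (hD : IsDigraph E) (hhom : DigraphCHom E) {e : V × V}
    (he : E e.1 e.2) :
    ((DeltaGraph E e).induce (Tails E e ∪ Heads E e)).Connected := by
  have h0 : e.1 ∈ Tails E e ∪ Heads E e :=
    Or.inl ((mem_tails_iff hD hhom he).2 (SimpleGraph.Reachable.refl _))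
  have key : ∀ z, Relation.ReflTransGen (altGraph E).Adj (e.1, true) z →
      ∃ h : z.1 ∈ Tails E e ∪ Heads E e,
        ((DeltaGraph E e).induce (Tails E e ∪ Heads E e)).Reachable ⟨e.1, h0⟩ ⟨z.1, h⟩ := by
    intro z hz
    induction hz with
    | refl => exact ⟨h0, SimpleGraph.Reachable.refl _⟩
    | @tail y z hy hyz ih =>
      obtain ⟨h1, h2⟩ := ih
      rw [← SimpleGraph.reachable_iff_reflTransGen] at hy
      have hadj : DeltaRel E e y.1 z.1 ∨ DeltaRel E e z.1 y.1 := by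
        simp only [deltaRel_iff hD he]
        have hz' := hy.trans hyz.reachable
        obtain ⟨y, b⟩ := y
        obtain ⟨z, c⟩ := z
        cases b
        · obtain ⟨rfl, hE⟩ := altGraph_adj_false.1 hyz
          exact Or.inr ⟨hE, hz'⟩
        · obtain ⟨rfl, hE⟩ := altGraph_adj_true.1 hyz
          exact Or.inl ⟨hE, hy⟩
      have hz'' : z.1 ∈ Tails E e ∪ Heads E e := hadj.elim (fun h => Or.inr ⟨_, h⟩)
        fun h => Or.inl ⟨_, h⟩
      refine ⟨hz'', h2.trans (SimpleGraph.Adj.reachable ?_)⟩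
      exact (deltaGraph_adj hD).2 hadj
  rw [SimpleGraph.connected_iff_exists_forall_reachable]
  refine ⟨⟨e.1, h0⟩, ?_⟩
  rintro ⟨v, hv | hv⟩
  · have := (mem_tails_iff hD hhom he).1 hv
    rw [SimpleGraph.reachable_iff_reflTransGen] at this
    exact (key _ this).2
  · have := (mem_heads_iff hD hhom he).1 hv
    rw [SimpleGraph.reachable_iff_reflTransGen] at this
    exact (key _ this).2

theorem IsAut.reachable_iff_of_meets {ψ : Equiv.Perm V} (hψ : IsAut E ψ) {o : V × Bool}
    {a : V} {b : Bool} (h1 : (altGraph E).Reachable o (a, b))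
    (h2 : (altGraph E).Reachable o (ψ a, b)) (x : V) (c : Bool) :
    (altGraph E).Reachable o (ψ x, c) ↔ (altGraph E).Reachable o (x, c) := by
  constructor
  · exact fun h => h1.trans (hψ.altGraph_reachable.1 (h2.symm.trans h))
  · exact fun h => h2.trans (hψ.altGraph_reachable.2 (h1.symm.trans h))

theorem AltSeparated.bipCHom (hD : IsDigraph E) (hhom : DigraphCHom E)
    (hs : AltSeparated E) {e : V × V} (he : E e.1 e.2) :
    BipCHom ((DeltaGraph E e).induce (Tails E e ∪ Heads E e))
      {v | v.1 ∈ Tails E e} {v | v.1 ∈ Heads E e} := by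
  intro A B hA hB hconn φ hadj hT hH
  have hinj : Function.Injective
      (Subtype.val : ((Tails E e ∪ Heads E e : Set V) : Type u) → V) := Subtype.val_injective
  let eA := Equiv.Set.image _ A hinj
  let eB := Equiv.Set.image _ B hinj
  have hconn' : ((UG E).induce (Subtype.val '' A)).Connected := by
    let f : (((DeltaGraph E e).induce (Tails E e ∪ Heads E e)).induce A) →g
        ((UG E).induce (Subtype.val '' A)) :=
      { toFun := eA
        map_rel' := by
          intro a b hab
          have hab' : (DeltaGraph E e).Adj a.1.1 b.1.1 := hab
          have : (UG E).Adj a.1.1 b.1.1 :=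
            hD.ug_adj.2 (((deltaGraph_adj hD).1 hab').imp And.left And.left)
          exact this }
    exact hconn.map f eA.surjective
  obtain ⟨ψ, hψ, hext⟩ := hhom _ _ (hA.image _) (hB.image _) hconn'
    ((eA.symm.trans φ).trans eB) (by
      intro a b
      obtain ⟨a, rfl⟩ := eA.surjective a
      obtain ⟨b, rfl⟩ := eA.surjective b
      simp only [Equiv.trans_apply, Equiv.symm_apply_apply]
      change E a.1.1 b.1.1 ↔ E (φ a).1.1 (φ b).1.1
      rw [hs.edge_iff hD hhom he a.1.2 b.1.2, hs.edge_iff hD hhom he (φ a).1.2 (φ b).1.2]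
      exact and_congr (hadj a b) (hT a))
  have hψφ : ∀ a : A, ψ a.1.1 = (φ a).1.1 := by
    intro a
    have := hext (eA a)
    simp only [Equiv.trans_apply, Equiv.symm_apply_apply] at this
    exact this
  have hψ' : IsAut E ψ := hψ
  have hpres : ∀ x c, (altGraph E).Reachable (e.1, true) (ψ x, c) ↔
      (altGraph E).Reachable (e.1, true) (x, c) := by
    obtain ⟨a⟩ := hconn.nonempty
    rcases a.1.2 with h | h
    · have h' : (φ a).1.1 ∈ Tails E e := (hT a).1 h
      rw [← hψφ] at h'
      exact hψ'.reachable_iff_of_meets ((mem_tails_iff hD hhom he).1 h)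
        ((mem_tails_iff hD hhom he).1 h')
    · have h' : (φ a).1.1 ∈ Heads E e := (hH a).1 h
      rw [← hψφ] at h'
      exact hψ'.reachable_iff_of_meets ((mem_heads_iff hD hhom he).1 h)
        ((mem_heads_iff hD hhom he).1 h')
  have pT : ∀ x, x ∈ Tails E e ↔ ψ x ∈ Tails E e := fun x => by
    rw [mem_tails_iff hD hhom he, mem_tails_iff hD hhom he, hpres]
  have pH : ∀ x, x ∈ Heads E e ↔ ψ x ∈ Heads E e := fun x => by
    rw [mem_heads_iff hD hhom he, mem_heads_iff hD hhom he, hpres]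
  have pΔ : ∀ x y, DeltaRel E e (ψ x) (ψ y) ↔ DeltaRel E e x y := fun x y => by
    rw [deltaRel_iff hD he, deltaRel_iff hD he, hpres, hψ]
  refine ⟨⟨ψ.subtypeEquiv fun x => or_congr (pT x) (pH x), ?_⟩, fun v => pT v.1,
    fun v => pH v.1, fun a => Subtype.ext (hψφ a)⟩
  intro x y
  change (DeltaGraph E e).Adj (ψ x.1) (ψ y.1) ↔ (DeltaGraph E e).Adj x.1 y.1
  rw [deltaGraph_adj hD, deltaGraph_adj hD, pΔ, pΔ]

end Reachability

/-- In a connected C-homogeneous triangle-free digraph with more than one end,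
the underlying graph of every reachability digraph is a connected C-homogeneous
bipartite graph with respect to the bipartition into tails and heads. -/
theorem stmt_11 {V : Type u} (E : V → V → Prop) (hD : IsDigraph E)
    (hconn : (UG E).Connected) (hhom : DigraphCHom E) (htf : ¬ HasTriangle E)
    (hends : MoreThanOneEnd (UG E)) (e : V × V) (he : E e.1 e.2) :
    IsBipartition ((DeltaGraph E e).induce (Tails E e ∪ Heads E e))
      {v | v.1 ∈ Tails E e} {v | v.1 ∈ Heads E e} ∧
    ((DeltaGraph E e).induce (Tails E e ∪ Heads E e)).Connected ∧
    BipCHom ((DeltaGraph E e).induce (Tails E e ∪ Heads E e))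
      {v | v.1 ∈ Tails E e} {v | v.1 ∈ Heads E e} := by
  have hs := altSeparated hD hconn hhom htf hends
  exact ⟨hs.isBipartition hD hhom he, deltaGraph_connected hD hhom he, hs.bipCHom hD hhom he⟩
end

section
/- Let G be a connected C-homogeneous bipartite graph with bipartition X ∪ Y. If G is not a tree and at least one vertex of G has degree greater than 2, then G contains an induced 4-cycle. -/
open Set

universe u

/-- The first `n` terms of `c` are the consecutive vertices of a cycle of length `n`. -/
def IsCyclicSeq {V : Type u} (G : SimpleGraph V) (n : ℕ) (c : ℕ → V) : Prop :=
  3 ≤ n ∧ (∀ i j, i < n → j < n → c i = c j → i = j) ∧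
  (∀ i, i + 1 < n → G.Adj (c i) (c (i + 1))) ∧ G.Adj (c (n - 1)) (c 0)

/-- The vertex `v` has degree at least three. -/
def HasThreeNeighbors {V : Type u} (G : SimpleGraph V) (v : V) : Prop :=
  ∃ a b c : V, a ≠ b ∧ a ≠ c ∧ b ≠ c ∧ G.Adj v a ∧ G.Adj v b ∧ G.Adj v c

/-- No two distinct vertices have two distinct common neighbours. -/
def NoFourCycle {V : Type u} (G : SimpleGraph V) : Prop :=
  ∀ a b c d, a ≠ c → b ≠ d → G.Adj a b → G.Adj b c → G.Adj c d → G.Adj d a → False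

/-- Consecutive vertices in cyclic order are adjacent and vertices two apart are distinct. -/
def IsHexagon {V : Type u} (G : SimpleGraph V) (a₀ a₁ a₂ a₃ a₄ a₅ : V) : Prop :=
  G.Adj a₀ a₁ ∧ G.Adj a₁ a₂ ∧ G.Adj a₂ a₃ ∧ G.Adj a₃ a₄ ∧ G.Adj a₄ a₅ ∧ G.Adj a₅ a₀ ∧
  a₀ ≠ a₂ ∧ a₂ ≠ a₄ ∧ a₀ ≠ a₄ ∧ a₁ ≠ a₃ ∧ a₃ ≠ a₅ ∧ a₁ ≠ a₅

section

variable {V : Type u} {G : SimpleGraph V} {X Y : Set V}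

theorem exists_isCyclicSeq (h : ¬ G.IsAcyclic) : ∃ n c, IsCyclicSeq G n c := by
  simp only [SimpleGraph.IsAcyclic, not_forall, not_not] at h
  obtain ⟨v, w, hw⟩ := h
  have h3 := hw.three_le_length
  refine ⟨w.length, w.getVert, h3, ?_, ?_, ?_⟩
  · intro i j hi hj hij
    exact hw.getVert_injOn' (by simp; omega) (by simp; omega) hij
  · intro i hi
    exact w.adj_getVert_succ (by omega)
  · have := w.adj_getVert_succ (i := w.length - 1) (by omega)
    rw [Nat.sub_add_cancel (by omega), w.getVert_length] at this
    rwa [w.getVert_zero]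

theorem IsCyclicSeq.rotate {n : ℕ} {c : ℕ → V} (h : IsCyclicSeq G n c) :
    IsCyclicSeq G n (fun i => if i + 1 < n then c (i + 1) else c 0) := by
  obtain ⟨h3, hinj, hadj, hlast⟩ := h
  refine ⟨h3, ?_, ?_, ?_⟩
  · intro i j hi hj hij
    dsimp only at hij
    split_ifs at hij with h1 h2 h2
    · have := hinj _ _ h1 h2 hij; omega
    · have := hinj _ _ h1 (by omega) hij; omega
    · have := hinj _ _ (by omega) h2 hij; omega
    · omega
  · intro i hi
    dsimp only
    rw [if_pos hi]
    split_ifs with h1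
    · exact hadj _ h1
    · rwa [show n - 1 = i + 1 by omega] at hlast
  · dsimp only
    rw [if_neg (by omega), if_pos (by omega)]
    exact hadj 0 (by omega)

theorem IsBipartition.mem_iff_of_adj (hbip : IsBipartition G X Y) {a b : V} (h : G.Adj a b) :
    a ∈ X ↔ b ∉ X := by
  obtain ⟨-, hd, he⟩ := hbip
  have hd := Set.disjoint_left.1 hd
  rcases he a b h with ⟨h1, h2⟩ | ⟨h1, h2⟩
  · exact ⟨fun _ h => hd h h2, fun _ => h1⟩
  · exact ⟨fun h => absurd h1 (hd h), fun h => absurd h2 h⟩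

theorem IsBipartition.mem_right_iff (hbip : IsBipartition G X Y) (a : V) : a ∈ Y ↔ a ∉ X := by
  obtain ⟨hu, hd, -⟩ := hbip
  have hd := Set.disjoint_left.1 hd
  have : a ∈ X ∪ Y := hu ▸ Set.mem_univ a
  exact ⟨fun h h' => hd h' h, fun h => this.resolve_left h⟩

/-- Isomorphic finite connected configurations, enumerated so that every vertex but the first has
an earlier neighbour, are related by an automorphism. -/
theorem BipCHom.exists_iso (hhom : BipCHom G X Y) (hbip : IsBipartition G X Y) {n : ℕ}
    {f g : Fin (n + 1) → V} (hf : f.Injective) (hg : g.Injective)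
    (hadj : ∀ i j, G.Adj (f i) (f j) ↔ G.Adj (g i) (g j))
    (htree : ∀ i, i ≠ 0 → ∃ j < i, G.Adj (f j) (f i)) (h0 : f 0 ∈ X ↔ g 0 ∈ X) :
    ∃ ψ : G ≃g G, ∀ i, ψ (f i) = g i := by
  have hside : ∀ i, f i ∈ X ↔ g i ∈ X := by
    intro i
    induction i using WellFoundedLT.induction with
    | ind i ih =>
      by_cases hi : i = 0
      · rwa [hi]
      · obtain ⟨j, hj, hji⟩ := htree i hi
        rw [hbip.mem_iff_of_adj hji.symm, hbip.mem_iff_of_adj ((hadj _ _).1 hji).symm, ih j hj]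
  have hconn : (G.induce (Set.range f)).Connected := by
    have key : ∀ i, (G.induce (Set.range f)).Reachable ⟨f 0, 0, rfl⟩ ⟨f i, i, rfl⟩ := by
      intro i
      induction i using WellFoundedLT.induction with
      | ind i ih =>
        by_cases hi : i = 0
        · subst hi; exact SimpleGraph.Reachable.refl _
        · obtain ⟨j, hj, hji⟩ := htree i hi
          exact (ih j hj).trans (SimpleGraph.Adj.reachable (by simpa using hji))
    rw [SimpleGraph.connected_iff_exists_forall_reachable]
    refine ⟨⟨f 0, 0, rfl⟩, ?_⟩
    rintro ⟨_, i, rfl⟩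
    exact key i
  let φ : Set.range f ≃ Set.range g := (Equiv.ofInjective f hf).symm.trans (Equiv.ofInjective g hg)
  have hφ : ∀ i, φ ⟨f i, i, rfl⟩ = ⟨g i, i, rfl⟩ := by
    intro i
    have : (⟨f i, i, rfl⟩ : Set.range f) = Equiv.ofInjective f hf i := rfl
    rw [this]
    simp only [φ, Equiv.trans_apply, Equiv.symm_apply_apply]
    rfl
  obtain ⟨ψ, -, -, hψ⟩ := hhom _ _ (Set.finite_range f) (Set.finite_range g) hconn φ
    (by rintro ⟨_, i, rfl⟩ ⟨_, j, rfl⟩; rw [hφ, hφ]; exact hadj i j)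
    (by rintro ⟨_, i, rfl⟩; rw [hφ]; exact hside i)
    (by
      rintro ⟨_, i, rfl⟩
      rw [hφ, hbip.mem_right_iff, hbip.mem_right_iff]
      exact not_congr (hside i))
  exact ⟨ψ, fun i => by rw [hψ ⟨f i, i, rfl⟩, hφ]⟩

/-- The last vertex of a connected configuration may be exchanged for one with the same
adjacencies. -/
theorem BipCHom.exists_iso_snoc (hhom : BipCHom G X Y) (hbip : IsBipartition G X Y) {n : ℕ}
    {f : Fin (n + 1) → V} (hf : f.Injective)
    (htree : ∀ i, i ≠ 0 → ∃ j < i, G.Adj (f j) (f i)) {u u' : V}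
    (hu : ∀ i, f i ≠ u) (hu' : ∀ i, f i ≠ u')
    (hadj : ∀ i, G.Adj (f i) u ↔ G.Adj (f i) u') (hex : ∃ i, G.Adj (f i) u) :
    ∃ ψ : G ≃g G, (∀ i, ψ (f i) = f i) ∧ ψ u = u' := by
  have hinj : ∀ w, (∀ i, f i ≠ w) → (Fin.snoc f w : Fin (n + 2) → V).Injective := by
    intro w hw
    rw [Fin.snoc_injective_iff]
    exact ⟨hf, by rintro ⟨i, hi⟩; exact hw i hi⟩
  have hadj' : ∀ i j : Fin (n + 2),
      G.Adj ((Fin.snoc f u : Fin (n + 2) → V) i) ((Fin.snoc f u : Fin (n + 2) → V) j) ↔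
        G.Adj ((Fin.snoc f u' : Fin (n + 2) → V) i) ((Fin.snoc f u' : Fin (n + 2) → V) j) := by
    intro i j
    induction i using Fin.lastCases with
    | last =>
      induction j using Fin.lastCases with
      | last => simp
      | cast j => simpa [G.adj_comm u, G.adj_comm u'] using hadj j
    | cast i =>
      induction j using Fin.lastCases with
      | last => simpa using hadj i
      | cast j => simp
  have htree' : ∀ i : Fin (n + 2), i ≠ 0 → ∃ j < i,
      G.Adj ((Fin.snoc f u : Fin (n + 2) → V) j) ((Fin.snoc f u : Fin (n + 2) → V) i) := by
    intro i hi
    induction i using Fin.lastCases with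
    | last =>
      obtain ⟨i, h⟩ := hex
      exact ⟨i.castSucc, Fin.castSucc_lt_last i, by simpa using h⟩
    | cast i =>
      obtain ⟨j, hj, h⟩ := htree i (by rintro rfl; exact hi rfl)
      exact ⟨j.castSucc, by simpa using hj, by simpa using h⟩
  obtain ⟨ψ, hψ⟩ := hhom.exists_iso hbip (hinj u hu) (hinj u' hu') hadj' htree' (by
    rw [show (0 : Fin (n + 2)) = Fin.castSucc 0 from rfl, Fin.snoc_castSucc, Fin.snoc_castSucc])
  exact ⟨ψ, fun i => by simpa using hψ i.castSucc, by simpa using hψ (Fin.last _)⟩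

theorem HasThreeNeighbors.exists_ne {v : V} (h : HasThreeNeighbors G v) (x y : V) :
    ∃ z, G.Adj v z ∧ z ≠ x ∧ z ≠ y := by
  obtain ⟨a, b, c, hab, hac, hbc, ha, hb, hc⟩ := h
  by_cases h1 : a ≠ x ∧ a ≠ y
  · exact ⟨a, ha, h1⟩
  by_cases h2 : b ≠ x ∧ b ≠ y
  · exact ⟨b, hb, h2⟩
  exact ⟨c, hc, by grind⟩

theorem HasThreeNeighbors.of_same_side (hhom : BipCHom G X Y) (hbip : IsBipartition G X Y)
    {v w : V} (h : HasThreeNeighbors G v) (hvw : v ∈ X ↔ w ∈ X) : HasThreeNeighbors G w := by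
  obtain ⟨ψ, hψ⟩ := hhom.exists_iso hbip (n := 0) (f := fun _ => v) (g := fun _ => w)
    (fun i j _ => by omega) (fun i j _ => by omega)
    (by simp) (fun i hi => absurd (by omega) hi) hvw
  obtain ⟨a, b, c, hab, hac, hbc, ha, hb, hc⟩ := h
  have hw : ψ v = w := hψ 0
  subst hw
  exact ⟨ψ a, ψ b, ψ c, ψ.injective.ne hab, ψ.injective.ne hac, ψ.injective.ne hbc,
    ψ.map_adj_iff.2 ha, ψ.map_adj_iff.2 hb, ψ.map_adj_iff.2 hc⟩

theorem IsHexagon.rotate {a₀ a₁ a₂ a₃ a₄ a₅ : V} (h : IsHexagon G a₀ a₁ a₂ a₃ a₄ a₅) :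
    IsHexagon G a₁ a₂ a₃ a₄ a₅ a₀ := by
  unfold IsHexagon at *
  grind

theorem adj_path_iff (hbip : IsBipartition G X Y) (hno : NoFourCycle G) {p₀ p₁ p₂ p₃ p₄ : V}
    (h01 : G.Adj p₀ p₁) (h12 : G.Adj p₁ p₂) (h23 : G.Adj p₂ p₃) (h34 : G.Adj p₃ p₄)
    (n02 : p₀ ≠ p₂) (n13 : p₁ ≠ p₃) (n24 : p₂ ≠ p₄) (i j : Fin 5) :
    G.Adj (![p₀, p₁, p₂, p₃, p₄] i) (![p₀, p₁, p₂, p₃, p₄] j) ↔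
      (i.val + 1 = j.val ∨ j.val + 1 = i.val) := by
  have s01 := hbip.mem_iff_of_adj h01
  have s12 := hbip.mem_iff_of_adj h12
  have s23 := hbip.mem_iff_of_adj h23
  have s34 := hbip.mem_iff_of_adj h34
  have a02 : ¬ G.Adj p₀ p₂ := fun h => by have := hbip.mem_iff_of_adj h; tauto
  have a04 : ¬ G.Adj p₀ p₄ := fun h => by have := hbip.mem_iff_of_adj h; tauto
  have a24 : ¬ G.Adj p₂ p₄ := fun h => by have := hbip.mem_iff_of_adj h; tauto
  have a13 : ¬ G.Adj p₁ p₃ := fun h => by have := hbip.mem_iff_of_adj h; tauto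
  have a03 : ¬ G.Adj p₀ p₃ := fun h => hno _ _ _ _ n02 n13 h01 h12 h23 h.symm
  have a14 : ¬ G.Adj p₁ p₄ := fun h => hno _ _ _ _ n13 n24 h12 h23 h34 h.symm
  fin_cases i <;> fin_cases j <;> simp [*, G.adj_comm]

theorem injective_path (hbip : IsBipartition G X Y) {p₀ p₁ p₂ p₃ p₄ : V}
    (h01 : G.Adj p₀ p₁) (h12 : G.Adj p₁ p₂) (h23 : G.Adj p₂ p₃) (h34 : G.Adj p₃ p₄)
    (n02 : p₀ ≠ p₂) (n13 : p₁ ≠ p₃) (n24 : p₂ ≠ p₄) (n04 : p₀ ≠ p₄) :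
    (![p₀, p₁, p₂, p₃, p₄]).Injective := by
  have s01 := hbip.mem_iff_of_adj h01
  have s12 := hbip.mem_iff_of_adj h12
  have s23 := hbip.mem_iff_of_adj h23
  have s34 := hbip.mem_iff_of_adj h34
  have n03 : p₀ ≠ p₃ := by rintro rfl; tauto
  have n14 : p₁ ≠ p₄ := by rintro rfl; tauto
  have n01 := h01.ne
  have n12 := h12.ne
  have n23 := h23.ne
  have n34 := h34.ne
  intro i j hij
  fin_cases i <;> fin_cases j <;>
    first
    | rfl
    | exact absurd hij (by assumption)
    | exact absurd hij.symm (by assumption)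

theorem IsHexagon.exists_common_neighbor_of_same_side (hhom : BipCHom G X Y)
    (hbip : IsBipartition G X Y) (hno : NoFourCycle G) {a₀ a₁ a₂ a₃ a₄ a₅ : V}
    (h : IsHexagon G a₀ a₁ a₂ a₃ a₄ a₅) {p₀ p₁ p₂ p₃ p₄ : V}
    (h01 : G.Adj p₀ p₁) (h12 : G.Adj p₁ p₂) (h23 : G.Adj p₂ p₃) (h34 : G.Adj p₃ p₄)
    (n02 : p₀ ≠ p₂) (n13 : p₁ ≠ p₃) (n24 : p₂ ≠ p₄) (n04 : p₀ ≠ p₄)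
    (hs : a₀ ∈ X ↔ p₀ ∈ X) : ∃ q, G.Adj p₀ q ∧ G.Adj p₄ q := by
  obtain ⟨b01, b12, b23, b34, b45, b50, m02, m24, m04, m13, -, -⟩ := h
  obtain ⟨ψ, hψ⟩ := hhom.exists_iso hbip
    (injective_path hbip b01 b12 b23 b34 m02 m13 m24 m04)
    (injective_path hbip h01 h12 h23 h34 n02 n13 n24 n04)
    (fun i j => by
      rw [adj_path_iff hbip hno b01 b12 b23 b34 m02 m13 m24,
        adj_path_iff hbip hno h01 h12 h23 h34 n02 n13 n24])
    (fun i hi => by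
      have hi' : i.val ≠ 0 := fun h => hi (Fin.ext h)
      refine ⟨⟨i.val - 1, by omega⟩, ?_, ?_⟩
      · rw [Fin.lt_def]; simp only; omega
      · rw [adj_path_iff hbip hno b01 b12 b23 b34 m02 m13 m24]; simp only; omega)
    hs
  have e0 : ψ a₀ = p₀ := hψ 0
  have e4 : ψ a₄ = p₄ := hψ 4
  exact ⟨ψ a₅, e0 ▸ ψ.map_adj_iff.2 b50.symm, e4 ▸ ψ.map_adj_iff.2 b45⟩

theorem IsHexagon.exists_common_neighbor (hhom : BipCHom G X Y)
    (hbip : IsBipartition G X Y) (hno : NoFourCycle G) {a₀ a₁ a₂ a₃ a₄ a₅ : V}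
    (h : IsHexagon G a₀ a₁ a₂ a₃ a₄ a₅) {p₀ p₁ p₂ p₃ p₄ : V}
    (h01 : G.Adj p₀ p₁) (h12 : G.Adj p₁ p₂) (h23 : G.Adj p₂ p₃) (h34 : G.Adj p₃ p₄)
    (n02 : p₀ ≠ p₂) (n13 : p₁ ≠ p₃) (n24 : p₂ ≠ p₄) (n04 : p₀ ≠ p₄) :
    ∃ q, G.Adj p₀ q ∧ G.Adj p₄ q := by
  by_cases hs : a₀ ∈ X ↔ p₀ ∈ X
  · exact h.exists_common_neighbor_of_same_side hhom hbip hno h01 h12 h23 h34 n02 n13 n24 n04 hs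
  · refine h.rotate.exists_common_neighbor_of_same_side hhom hbip hno h01 h12 h23 h34
      n02 n13 n24 n04 ?_
    have := hbip.mem_iff_of_adj h.1
    tauto

/-- In a `C`-homogeneous bipartite graph of minimum degree at least three, a hexagon forces a
4-cycle. -/
theorem IsHexagon.false_of_noFourCycle (hhom : BipCHom G X Y) (hbip : IsBipartition G X Y)
    (hno : NoFourCycle G) {a₀ a₁ a₂ a₃ a₄ a₅ : V} (h : IsHexagon G a₀ a₁ a₂ a₃ a₄ a₅)
    (hdeg : ∀ w, HasThreeNeighbors G w) : False := by
  obtain ⟨l₁, l₂, l₃, n12, n13, n23, x1, x2, x3⟩ := hdeg a₀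
  generalize a₀ = x at x1 x2 x3 h
  obtain ⟨p₁, q1, r1, -⟩ := (hdeg l₁).exists_ne x x
  obtain ⟨p₂, q2, r2, -⟩ := (hdeg l₂).exists_ne x x
  have no : ∀ l l' p, l ≠ l' → p ≠ x → G.Adj x l → G.Adj x l' → G.Adj l p → ¬ G.Adj l' p :=
    fun l l' p hl hp h1 h2 h3 h4 => hno x l p l' hp.symm hl h1 h3 h4.symm h2.symm
  have a12 := no l₂ l₁ p₂ n12.symm r2 x2 x1 q2
  have a21 := no l₁ l₂ p₁ n12 r1 x1 x2 q1
  have a13 := no l₁ l₃ p₁ n13 r1 x1 x3 q1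
  have a23 := no l₂ l₃ p₂ n23 r2 x2 x3 q2
  have np12 : p₁ ≠ p₂ := by rintro rfl; exact a12 q1
  obtain ⟨m, m1, m2⟩ := h.exists_common_neighbor hhom hbip hno q1.symm x1.symm x2 q2
    r1 n12 r2.symm np12
  have ml1 : m ≠ l₁ := by rintro rfl; exact a12 m2.symm
  have ml2 : m ≠ l₂ := by rintro rfl; exact a21 m1.symm
  have ml3 : m ≠ l₃ := by rintro rfl; exact a13 m1.symm
  obtain ⟨p₃, hm3, q3⟩ := h.exists_common_neighbor hhom hbip hno m1.symm q1.symm x1.symm x3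
    ml1 r1 n13 ml3
  have r3 : p₃ ≠ x := by
    rintro rfl
    exact no l₁ m p₁ ml1.symm r1 x1 hm3.symm q1 m1.symm
  obtain ⟨p₄, q4, r4, r34⟩ := (hdeg l₃).exists_ne x p₃
  have hm4 : ¬ G.Adj m p₄ := fun h4 => hno _ _ _ _ ml3 r34.symm hm3 q3.symm q4 h4.symm
  have opp : ∀ l, G.Adj x l → (l ∈ X ↔ x ∉ X) := fun l hl => hbip.mem_iff_of_adj hl.symm
  have same : ∀ l p, G.Adj x l → G.Adj l p → (p ∈ X ↔ x ∈ X) := fun l p hl hp => by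
    rw [hbip.mem_iff_of_adj hp.symm, opp l hl, not_not]
  have nadj : ∀ w p, (w ∈ X ↔ x ∈ X) → (p ∈ X ↔ x ∈ X) → ¬ G.Adj w p := fun w p hw hp ha =>
    iff_not_self (hp.symm.trans ((hbip.mem_iff_of_adj ha.symm).trans (not_congr hw)))
  have ne_of : ∀ l p, (l ∈ X ↔ x ∉ X) → (p ∈ X ↔ x ∈ X) → l ≠ p := by
    rintro l _ hl hp rfl
    exact iff_not_self (hp.symm.trans hl)
  have o1 := opp l₁ x1
  have o2 := opp l₂ x2
  have o3 := opp l₃ x3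
  have s1 := same l₁ p₁ x1 q1
  have s2 := same l₂ p₂ x2 q2
  have hne : ∀ p, G.Adj l₃ p → p ≠ x → ∀ i, ![x, l₁, l₂, l₃, p₁, p₂] i ≠ p := by
    intro p hp hpx i
    have hps := same l₃ p x3 hp
    fin_cases i
    · exact hpx.symm
    · exact ne_of l₁ p o1 hps
    · exact ne_of l₂ p o2 hps
    · exact hp.ne
    · rintro rfl; exact a13 hp
    · rintro rfl; exact a23 hp
  have hadj : ∀ p, G.Adj l₃ p → p ≠ x → ∀ i : Fin 6,
      G.Adj (![x, l₁, l₂, l₃, p₁, p₂] i) p ↔ i = 3 := by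
    intro p hp hpx i
    have hps := same l₃ p x3 hp
    fin_cases i
    · exact iff_of_false (nadj x p Iff.rfl hps) (by decide)
    · exact iff_of_false (no l₃ l₁ p n13.symm hpx x3 x1 hp) (by decide)
    · exact iff_of_false (no l₃ l₂ p n23.symm hpx x3 x2 hp) (by decide)
    · exact iff_of_true hp (by decide)
    · exact iff_of_false (nadj p₁ p s1 hps) (by decide)
    · exact iff_of_false (nadj p₂ p s2 hps) (by decide)
  have hinj : (![x, l₁, l₂, l₃, p₁, p₂]).Injective := by
    have k1 := ne_of l₁ p₁ o1 s1
    have k2 := ne_of l₁ p₂ o1 s2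
    have k3 := ne_of l₂ p₁ o2 s1
    have k4 := ne_of l₂ p₂ o2 s2
    have k5 := ne_of l₃ p₁ o3 s1
    have k6 := ne_of l₃ p₂ o3 s2
    have k7 := x1.ne
    have k8 := x2.ne
    have k9 := x3.ne
    intro i j hij
    fin_cases i <;> fin_cases j <;>
      first
      | rfl
      | exact absurd hij (by assumption)
      | exact absurd hij.symm (by assumption)
  have htree : ∀ i, i ≠ 0 → ∃ j < i,
      G.Adj (![x, l₁, l₂, l₃, p₁, p₂] j) (![x, l₁, l₂, l₃, p₁, p₂] i) := by
    intro i hi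
    fin_cases i
    · exact absurd rfl hi
    · exact ⟨0, by decide, x1⟩
    · exact ⟨0, by decide, x2⟩
    · exact ⟨0, by decide, x3⟩
    · exact ⟨1, by decide, q1⟩
    · exact ⟨2, by decide, q2⟩
  obtain ⟨ψ, hψ, hψ3⟩ := hhom.exists_iso_snoc hbip hinj htree (hne p₃ q3 r3) (hne p₄ q4 r4)
    (fun i => (hadj p₃ q3 r3 i).trans (hadj p₄ q4 r4 i).symm) ⟨3, q3⟩
  have e1 : ψ p₁ = p₁ := hψ 4
  have e2 : ψ p₂ = p₂ := hψ 5
  have f1 : G.Adj p₁ (ψ m) := by simpa only [e1] using ψ.map_adj_iff.2 m1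
  have f2 : G.Adj p₂ (ψ m) := by simpa only [e2] using ψ.map_adj_iff.2 m2
  have f3 : G.Adj (ψ m) p₄ := hψ3 ▸ ψ.map_adj_iff.2 hm3
  exact hno p₁ m p₂ (ψ m) np12 (fun he => hm4 (he ▸ f3)) m1 m2.symm f2 f1.symm

/-- A shortest cycle through a suitable vertex of degree at least three yields a hexagon, and all
vertices have degree at least three. -/
theorem exists_isHexagon (hhom : BipCHom G X Y) (hbip : IsBipartition G X Y)
    (hno : NoFourCycle G) {n : ℕ} {c : ℕ → V} (hc : IsCyclicSeq G n c)
    (hmin : ∀ m c', IsCyclicSeq G m c' → n ≤ m)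
    (hdeg : HasThreeNeighbors G (c (n - 3))) :
    (∃ a₀ a₁ a₂ a₃ a₄ a₅, IsHexagon G a₀ a₁ a₂ a₃ a₄ a₅) ∧ ∀ w, HasThreeNeighbors G w := by
  obtain ⟨h3, hinj, hadj, hlast⟩ := hc
  have hn3 : n ≠ 3 := by
    rintro rfl
    have h1 := hbip.mem_iff_of_adj (hadj 0 (by norm_num))
    have h2 := hbip.mem_iff_of_adj (hadj 1 (by norm_num))
    have h3 := hbip.mem_iff_of_adj hlast
    simp only [zero_add, Nat.reduceAdd, Nat.reduceSub] at h1 h2 h3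
    tauto
  have hn4 : n ≠ 4 := by
    rintro rfl
    refine hno (c 0) (c 1) (c 2) (c 3) ?_ ?_ (hadj 0 (by norm_num)) (hadj 1 (by norm_num))
      (hadj 2 (by norm_num)) hlast
    · intro h; have := hinj _ _ (by norm_num) (by norm_num) h; omega
    · intro h; have := hinj _ _ (by norm_num) (by norm_num) h; omega
  obtain ⟨k, rfl⟩ : ∃ k, n = k + 5 := ⟨n - 5, by omega⟩
  simp only [show k + 5 - 3 = k + 2 by omega, show k + 5 - 1 = k + 4 by omega] at hdeg hlast
  have hchord : ∀ i j, i + 1 < j → j < k + 4 → ¬ G.Adj (c i) (c j) := by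
    intro i j hij hj h
    have := hmin (j - i + 1) (fun t => c (i + t)) ⟨by omega, ?_, ?_, ?_⟩
    · omega
    · intro s t hs ht hst
      have := hinj _ _ (by omega) (by omega) hst
      omega
    · intro s hs
      exact hadj (i + s) (by omega)
    · simp only [Nat.add_sub_cancel, add_zero, Nat.add_sub_cancel' (show i ≤ j by omega)]
      exact h.symm
  obtain ⟨d, hd, hd3, hd1⟩ := hdeg.exists_ne (c (k + 3)) (c (k + 1))
  have hdc : ∀ i, i < k + 3 → c i ≠ d := by
    rintro i hi rfl
    rcases Nat.lt_or_ge (i + 1) (k + 2) with h | h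
    · exact hchord i (k + 2) h (by omega) hd.symm
    · obtain rfl | rfl : i = k + 1 ∨ i = k + 2 := by omega
      · exact hd1 rfl
      · exact hd.ne rfl
  have hda : ∀ i, i < k + 2 → ¬ G.Adj (c i) d := by
    intro i hi h
    have := hmin (k + 2 - i + 2) (fun t => if t < k + 3 - i then c (i + t) else d)
      ⟨by omega, ?_, ?_, ?_⟩
    · omega
    · intro s t hs ht hst
      dsimp only at hst
      split_ifs at hst with h1 h2 h2
      · have := hinj _ _ (by omega) (by omega) hst; omega
      · exact absurd hst (hdc _ (by omega))
      · exact absurd hst.symm (hdc _ (by omega))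
      · omega
    · intro s hs
      dsimp only
      rw [if_pos (by omega)]
      split_ifs with h1
      · exact hadj (i + s) (by omega)
      · rwa [show i + s = k + 2 by omega]
    · dsimp only
      rw [if_neg (by omega), if_pos (by omega)]
      exact h.symm
  have hne : ∀ i j, i < k + 5 → j < k + 5 → i ≠ j → c i ≠ c j :=
    fun i j hi hj hij h => hij (hinj i j hi hj h)
  have hd' : G.Adj (c (k + 2)) d := hd
  obtain ⟨ψ, hψ, hψd⟩ := hhom.exists_iso_snoc hbip (n := k + 2)
    (f := fun i => c i.val) (u := c (k + 3)) (u' := d)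
    (fun i j h => Fin.ext (hinj _ _ (by omega) (by omega) h))
    (fun i hi => by
      have hi' : i.val ≠ 0 := fun h => hi (Fin.ext h)
      refine ⟨⟨i.val - 1, by omega⟩, ?_, ?_⟩
      · rw [Fin.lt_def]; simp only; omega
      · have := hadj (i.val - 1) (by omega)
        rwa [Nat.sub_add_cancel (by omega)] at this)
    (fun i => hne _ _ (by omega) (by omega) (by omega))
    (fun i => hdc _ i.isLt)
    (fun i => by
      rcases Nat.lt_or_ge i.val (k + 2) with h | h
      · exact iff_of_false (hchord _ _ (by omega) (by omega)) (hda _ h)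
      · have hi : i.val = k + 2 := by omega
        rw [hi]
        exact iff_of_true (hadj _ (by omega)) hd)
    ⟨⟨k + 2, by omega⟩, hadj _ (by omega)⟩
  have e0 : ψ (c 0) = c 0 := hψ ⟨0, by omega⟩
  have e1 : ψ (c 1) = c 1 := hψ ⟨1, by omega⟩
  have e2 : ψ (c (k + 2)) = c (k + 2) := hψ ⟨k + 2, by omega⟩
  have a23 := hadj (k + 2) (by omega)
  have a34 := hadj (k + 3) (by omega)
  have q0 : G.Adj (ψ (c (k + 4))) (c 0) := by
    have := ψ.map_adj_iff.2 hlast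
    rwa [e0] at this
  have qd : G.Adj d (ψ (c (k + 4))) := by
    have := ψ.map_adj_iff.2 a34
    rwa [hψd] at this
  have q1 : ψ (c (k + 4)) ≠ c 1 := by
    rw [← e1]
    exact ψ.injective.ne (hne _ _ (by omega) (by omega) (by omega))
  have q2 : ψ (c (k + 4)) ≠ c (k + 2) := by
    rw [← e2]
    exact ψ.injective.ne (hne _ _ (by omega) (by omega) (by omega))
  have n24 : c (k + 4) ≠ c (k + 2) := hne _ _ (by omega) (by omega) (by omega)
  have q4 : ψ (c (k + 4)) ≠ c (k + 4) := by
    intro h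
    rw [h] at qd
    exact hno _ _ _ _ hd3 n24.symm hd'.symm a23 a34 qd.symm
  refine ⟨⟨c 0, c (k + 4), c (k + 3), c (k + 2), d, ψ (c (k + 4)), hlast.symm, a34.symm, a23.symm,
    hd, qd, q0, hne _ _ (by omega) (by omega) (by omega), hd3.symm, hdc 0 (by omega),
    n24, q2.symm, q4.symm⟩, fun w => ?_⟩
  have hdeg0 : HasThreeNeighbors G (c 0) :=
    ⟨c 1, c (k + 4), ψ (c (k + 4)), hne _ _ (by omega) (by omega) (by omega), q1.symm, q4.symm,
      hadj 0 (by omega), hlast.symm, q0.symm⟩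
  have s1 := hbip.mem_iff_of_adj a23
  have s2 := hbip.mem_iff_of_adj a34
  have s3 := hbip.mem_iff_of_adj hlast
  by_cases hw : c (k + 2) ∈ X ↔ w ∈ X
  · exact hdeg.of_same_side hhom hbip hw
  · exact hdeg0.of_same_side hhom hbip (by tauto)

end

/-- A connected C-homogeneous bipartite graph that is not a tree and has a vertex
of degree greater than 2 contains an induced 4-cycle. -/
theorem stmt_12 {V : Type u} (G : SimpleGraph V) (X Y : Set V)
    (hbip : IsBipartition G X Y) (hconn : G.Connected) (hhom : BipCHom G X Y)
    (hnt : ¬ G.IsTree)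
    (hdeg : ∃ v a b c : V, a ≠ b ∧ a ≠ c ∧ b ≠ c ∧
      G.Adj v a ∧ G.Adj v b ∧ G.Adj v c) :
    ∃ a b c d : V, a ≠ b ∧ a ≠ c ∧ a ≠ d ∧ b ≠ c ∧ b ≠ d ∧ c ≠ d ∧
      G.Adj a b ∧ G.Adj b c ∧ G.Adj c d ∧ G.Adj d a ∧
      ¬ G.Adj a c ∧ ¬ G.Adj b d := by
  by_contra hgoal
  have hno : NoFourCycle G := by
    intro a b c d hac hbd hab hbc hcd hda
    refine hgoal ⟨a, b, c, d, hab.ne, hac, hda.ne.symm, hbc.ne, hbd, hcd.ne, hab, hbc, hcd, hda,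
      fun h => ?_, fun h => ?_⟩
    · have h1 := hbip.mem_iff_of_adj h
      have h2 := hbip.mem_iff_of_adj hab
      have h3 := hbip.mem_iff_of_adj hbc
      tauto
    · have h1 := hbip.mem_iff_of_adj h
      have h2 := hbip.mem_iff_of_adj hbc
      have h3 := hbip.mem_iff_of_adj hcd
      tauto
  obtain ⟨v, hv⟩ := hdeg
  have hv : HasThreeNeighbors G v := hv
  have hex : ∃ n c, IsCyclicSeq G n c := exists_isCyclicSeq fun h => hnt ⟨hconn, h⟩
  classical
  obtain ⟨c, hc⟩ := Nat.find_spec hex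
  have hmin : ∀ m c', IsCyclicSeq G m c' → Nat.find hex ≤ m :=
    fun m c' h => Nat.find_min' hex ⟨c', h⟩
  generalize Nat.find hex = n at hc hmin
  have h3 := hc.1
  have key : (∃ a₀ a₁ a₂ a₃ a₄ a₅, IsHexagon G a₀ a₁ a₂ a₃ a₄ a₅) ∧
      ∀ w, HasThreeNeighbors G w := by
    by_cases hs : v ∈ X ↔ c (n - 3) ∈ X
    · exact exists_isHexagon hhom hbip hno hc hmin (hv.of_same_side hhom hbip hs)
    · refine exists_isHexagon hhom hbip hno hc.rotate hmin (hv.of_same_side hhom hbip ?_)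
      rw [if_pos (by omega)]
      have := hbip.mem_iff_of_adj (hc.2.2.1 (n - 3) (by omega))
      tauto
  obtain ⟨⟨a₀, a₁, a₂, a₃, a₄, a₅, hex⟩, hall⟩ := key
  exact hex.false_of_noFourCycle hhom hbip hno hall
end

section
/- Let G be a connected C-homogeneous bipartite graph and let {x,y} be an edge of G. Then the neighbourhood graph Ω(x,y), namely the subgraph of G induced on (N(x) ∪ N(y)) ∖ {x,y}, is a homogeneous bipartite graph with respect to the bipartition into N(y) ∖ {x} and N(x) ∖ {y}. -/
open Set

universe u

/-- In a C-homogeneous bipartite graph, a map which is injective on a finite connected set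
and preserves adjacency and sides there agrees on it with a side-preserving automorphism. -/
theorem BipCHom.exists_iso_of_injOn {V : Type u} {G : SimpleGraph V} {X Y : Set V}
    (hhom : BipCHom G X Y) {A : Set V} (hA : A.Finite) (hconn : (G.induce A).Connected)
    {f : V → V} (hf : InjOn f A) (hadj : ∀ a ∈ A, ∀ b ∈ A, (G.Adj a b ↔ G.Adj (f a) (f b)))
    (hX : ∀ a ∈ A, (a ∈ X ↔ f a ∈ X)) (hY : ∀ a ∈ A, (a ∈ Y ↔ f a ∈ Y)) :
    ∃ ψ : G ≃g G, ∀ a ∈ A, ψ a = f a := by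
  obtain ⟨ψ, -, -, hψ⟩ := hhom A (f '' A) hA (hA.image f) hconn
    (Equiv.ofBijective _ hf.bijOn_image.bijective)
    (fun a b => hadj a a.2 b b.2) (fun a => hX a a.2) (fun a => hY a a.2)
  exact ⟨ψ, fun a ha => hψ ⟨a, ha⟩⟩

/-- A set containing an edge `{x, y}`, all of whose other vertices are adjacent to `x` or `y`,
induces a connected subgraph. -/
theorem connected_induce_of_dominating_edge {V : Type u} {G : SimpleGraph V} {x y : V}
    (hxy : G.Adj x y) {A : Set V} (hx : x ∈ A) (hy : y ∈ A)
    (hA : ∀ a ∈ A, G.Adj x a ∨ G.Adj y a) : (G.induce A).Connected := by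
  rw [SimpleGraph.connected_iff_exists_forall_reachable]
  have hxy' : (G.induce A).Adj ⟨x, hx⟩ ⟨y, hy⟩ := hxy
  refine ⟨⟨x, hx⟩, fun ⟨a, ha⟩ => ?_⟩
  rcases hA a ha with h | h
  · exact SimpleGraph.Adj.reachable (G := G.induce A) (u := ⟨x, hx⟩) (v := ⟨a, ha⟩) h
  · exact hxy'.reachable.trans
      (SimpleGraph.Adj.reachable (G := G.induce A) (u := ⟨y, hy⟩) (v := ⟨a, ha⟩) h)

/-- For every edge `{x,y}` of a connected C-homogeneous bipartite graph, the
neighbourhood graph `Ω(x,y)` is a homogeneous bipartite graph with respect to the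
bipartition into `N(y) ∖ {x}` and `N(x) ∖ {y}`. -/
theorem stmt_13 {V : Type u} (G : SimpleGraph V) (X Y : Set V)
    (hbip : IsBipartition G X Y) (hconn : G.Connected) (hhom : BipCHom G X Y)
    (x y : V) (hxy : G.Adj x y) :
    IsBipartition (G.induce ((G.neighborSet x ∪ G.neighborSet y) \ {x, y}))
      {v | v.1 ∈ G.neighborSet y \ {x}} {v | v.1 ∈ G.neighborSet x \ {y}} ∧
    BipHom (G.induce ((G.neighborSet x ∪ G.neighborSet y) \ {x, y}))
      {v | v.1 ∈ G.neighborSet y \ {x}} {v | v.1 ∈ G.neighborSet x \ {y}} := by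
  classical
  obtain ⟨hcover, hdisj, hedge⟩ := hbip
  have hmem : ∀ a, a ∈ X ∨ a ∈ Y := fun a => (hcover ▸ mem_univ a : a ∈ X ∪ Y)
  have hnot : ∀ a, a ∈ X → a ∈ Y → False := fun _ h₁ h₂ =>
    disjoint_left.1 hdisj h₁ h₂
  have htri : ∀ a, G.Adj x a → G.Adj y a → False := fun a h₁ h₂ => by
    have := hedge _ _ hxy
    have := hedge _ _ h₁
    have := hedge _ _ h₂
    have := hnot x
    have := hnot y
    have := hnot a
    tauto
  constructor
  · refine ⟨?_, ?_, ?_⟩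
    · ext ⟨a, h⟩
      simp only [mem_sdiff, mem_union, SimpleGraph.mem_neighborSet, mem_insert_iff,
        mem_singleton_iff, mem_ofPred_eq, mem_univ, iff_true] at h ⊢
      tauto
    · rw [disjoint_left]
      rintro ⟨a, h⟩ h₁ h₂
      exact htri a h₂.1 h₁.1
    · rintro ⟨a, ha⟩ ⟨b, hb⟩ hab
      have hab' : G.Adj a b := hab
      have := hedge _ _ hab'
      have := hedge _ _ hxy
      have := hedge x a
      have := hedge x b
      have := hedge y a
      have := hedge y b
      have := hnot x
      have := hnot y
      have := hnot a
      have := hnot b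
      simp only [mem_sdiff, mem_union, SimpleGraph.mem_neighborSet, mem_insert_iff,
        mem_singleton_iff, mem_ofPred_eq] at ha hb ⊢
      grind
  · set Ω : Set V := (G.neighborSet x ∪ G.neighborSet y) \ {x, y}
    intro A B hA _ φ hφ hφy hφx
    have hΩx : ∀ v ∈ Ω, v ≠ x := fun v hv h => hv.2 (Or.inl h)
    have hΩy : ∀ v ∈ Ω, v ≠ y := fun v hv h => hv.2 (Or.inr h)
    have hΩadj : ∀ v ∈ Ω, G.Adj x v ∨ G.Adj y v := fun v hv => hv.1
    have hAx : ∀ a : A, G.Adj x a.1.1 ↔ G.Adj x (φ a).1.1 := fun a => by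
      simpa [hΩy _ a.1.2, hΩy _ (φ a).1.2] using hφx a
    have hAy : ∀ a : A, G.Adj y a.1.1 ↔ G.Adj y (φ a).1.1 := fun a => by
      simpa [hΩx _ a.1.2, hΩx _ (φ a).1.2] using hφy a
    let f : V → V := fun v =>
      if h : ∃ h : v ∈ Ω, (⟨v, h⟩ : Ω) ∈ A then (φ ⟨⟨v, h.1⟩, h.2⟩).1.1 else v
    have hfA : ∀ a : A, f a.1.1 = (φ a).1.1 := fun a => dif_pos ⟨a.1.2, a.2⟩
    have hfx : f x = x := dif_neg fun h => hΩx x h.1 rfl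
    have hfy : f y = y := dif_neg fun h => hΩy y h.1 rfl
    let A' : Set V := {x, y} ∪ Subtype.val '' A
    have hcases : ∀ {p : V → Prop}, p x → p y → (∀ a : A, p a.1.1) → ∀ v ∈ A', p v := by
      rintro p hx hy ha v ((rfl | rfl) | ⟨a, h, rfl⟩)
      exacts [hx, hy, ha ⟨a, h⟩]
    have hside : ∀ a : A, (a.1.1 ∈ X ↔ (φ a).1.1 ∈ X) ∧ (a.1.1 ∈ Y ↔ (φ a).1.1 ∈ Y) := by
      intro a
      have := hAx a
      have := hAy a
      have := hΩadj _ a.1.2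
      have := hedge _ _ hxy
      have := hedge x a.1.1
      have := hedge x (φ a).1.1
      have := hedge y a.1.1
      have := hedge y (φ a).1.1
      have := hnot x
      have := hnot y
      have := hnot a.1.1
      have := hnot (φ a).1.1
      grind
    obtain ⟨ψ, hψ⟩ := hhom.exists_iso_of_injOn (A := A') (f := f)
      ((toFinite {x, y}).union (hA.image _))
      (connected_induce_of_dominating_edge hxy (Or.inl (Or.inl rfl)) (Or.inl (Or.inr rfl))
        (hcases (Or.inr hxy.symm) (Or.inl hxy) fun a => hΩadj _ a.1.2))
      (by
        refine hcases (p := fun u => ∀ ⦃v⦄, v ∈ A' → f u = f v → u = v) ?_ ?_ fun a => ?_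
        · refine hcases (p := fun v => f x = f v → x = v) ?_ ?_ fun b => ?_
          · simp
          · simp [hfx, hfy]
          · rw [hfx, hfA]
            exact fun h => (hΩx _ (φ b).1.2 h.symm).elim
        · refine hcases (p := fun v => f y = f v → y = v) ?_ ?_ fun b => ?_
          · simp [hfx, hfy]
          · simp
          · rw [hfy, hfA]
            exact fun h => (hΩy _ (φ b).1.2 h.symm).elim
        · refine hcases (p := fun v => f a.1.1 = f v → a.1.1 = v) ?_ ?_ fun b => ?_
          · rw [hfx, hfA]
            exact fun h => (hΩx _ (φ a).1.2 h).elim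
          · rw [hfy, hfA]
            exact fun h => (hΩy _ (φ a).1.2 h).elim
          · rw [hfA, hfA]
            intro h
            rw [φ.injective (Subtype.ext (Subtype.ext h))])
      (by
        refine hcases ?_ ?_ fun a => ?_
        · refine hcases ?_ ?_ fun b => ?_
          · rw [hfx]
          · rw [hfx, hfy]
          · rw [hfx, hfA, hAx]
        · refine hcases ?_ ?_ fun b => ?_
          · rw [hfx, hfy]
          · rw [hfy]
          · rw [hfy, hfA, hAy]
        · refine hcases ?_ ?_ fun b => ?_
          · rw [hfx, hfA, G.adj_comm, hAx, G.adj_comm]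
          · rw [hfy, hfA, G.adj_comm, hAy, G.adj_comm]
          · rw [hfA, hfA]
            exact hφ a b)
      (hcases (by rw [hfx]) (by rw [hfy]) fun a => by rw [hfA]; exact (hside a).1)
      (hcases (by rw [hfx]) (by rw [hfy]) fun a => by rw [hfA]; exact (hside a).2)
    have hψx : ψ x = x := (hψ x (Or.inl (Or.inl rfl))).trans hfx
    have hψy : ψ y = y := (hψ y (Or.inl (Or.inr rfl))).trans hfy
    have hNx : ∀ v, G.Adj x v ↔ G.Adj x (ψ v) := fun v => by
      rw [← ψ.map_adj_iff, hψx]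
    have hNy : ∀ v, G.Adj y v ↔ G.Adj y (ψ v) := fun v => by
      rw [← ψ.map_adj_iff, hψy]
    have hex : ∀ v, v = x ↔ ψ v = x := fun v => by
      rw [← ψ.injective.eq_iff, hψx]
    have hey : ∀ v, v = y ↔ ψ v = y := fun v => by
      rw [← ψ.injective.eq_iff, hψy]
    refine ⟨⟨ψ.toEquiv.subtypeEquiv fun v => ?_, fun {a b} => ψ.map_adj_iff⟩,
      fun v => ?_, fun v => ?_, fun a => Subtype.ext ?_⟩
    · change ((G.Adj x v ∨ G.Adj y v) ∧ ¬ (v = x ∨ v = y)) ↔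
        ((G.Adj x (ψ v) ∨ G.Adj y (ψ v)) ∧ ¬ (ψ v = x ∨ ψ v = y))
      rw [← hNx, ← hNy, ← hex, ← hey]
    · exact and_congr (hNy v) (not_congr (hex v))
    · exact and_congr (hNx v) (not_congr (hey v))
    · exact (hψ a.1.1 (Or.inr ⟨a.1, a.2, rfl⟩)).trans (hfA a)
end

section
/- Every C-homogeneous generic bipartite graph is homogeneous bipartite. -/
open Set

universe u

/-- `BipCHom` in terms of injective families of vertices. -/
theorem BipCHom.exists_iso_of_injective {V : Type u} {G : SimpleGraph V} {X Y : Set V}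
    (hhom : BipCHom G X Y) {ι : Type*} [Finite ι] {f g : ι → V}
    (hf : Function.Injective f) (hg : Function.Injective g)
    (hconn : (G.induce (range f)).Connected)
    (hadj : ∀ i j, G.Adj (f i) (f j) ↔ G.Adj (g i) (g j))
    (hX : ∀ i, f i ∈ X ↔ g i ∈ X) (hY : ∀ i, f i ∈ Y ↔ g i ∈ Y) :
    ∃ ψ : G ≃g G, (∀ v, v ∈ X ↔ ψ v ∈ X) ∧ (∀ v, v ∈ Y ↔ ψ v ∈ Y) ∧
      ∀ i, ψ (f i) = g i := by
  have key : ∀ i, ((Equiv.ofInjective f hf).symm.trans (Equiv.ofInjective g hg)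
      ⟨f i, mem_range_self i⟩).1 = g i := fun i => by
    simp only [Equiv.trans_apply, Equiv.ofInjective_symm_apply, Equiv.ofInjective_apply]
  obtain ⟨ψ, h₁, h₂, h₃⟩ := hhom (range f) (range g) (finite_range f) (finite_range g) hconn
    ((Equiv.ofInjective f hf).symm.trans (Equiv.ofInjective g hg))
    (by rintro ⟨_, i, rfl⟩ ⟨_, j, rfl⟩; rw [key, key]; exact hadj i j)
    (by rintro ⟨_, i, rfl⟩; rw [key]; exact hX i)
    (by rintro ⟨_, i, rfl⟩; rw [key]; exact hY i)
  exact ⟨ψ, h₁, h₂, fun i => (h₃ ⟨f i, mem_range_self i⟩).trans (key i)⟩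

/-- A finite vertex set of a generic bipartite graph is dominated by an edge outside it. -/
theorem GenericBip.exists_dominating_edge {V : Type u} {G : SimpleGraph V} {X Y : Set V}
    (hbip : IsBipartition G X Y) (hgen : GenericBip G X Y) {A : Set V} (hA : A.Finite) :
    ∃ x ∈ X, ∃ y ∈ Y, x ∉ A ∧ y ∉ A ∧ G.Adj x y ∧
      (∀ a ∈ A, G.Adj x a ↔ a ∈ Y) ∧ ∀ a ∈ A, G.Adj y a ↔ a ∈ X := by
  obtain ⟨-, hdisj, hadj⟩ := hbip
  have hXY : ∀ v, v ∈ X → v ∉ Y := fun v hx hy => disjoint_left.1 hdisj hx hy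
  have hAX : (A ∩ X).Finite := hA.subset inter_subset_left
  have hAY : (A ∩ Y).Finite := hA.subset inter_subset_left
  obtain ⟨x₀, hx₀, -, hx₀A⟩ := hgen.2 ∅ (A ∩ Y) (empty_subset _) inter_subset_right
    finite_empty hAY (empty_disjoint _)
  obtain ⟨y, hy, hyA, -⟩ := hgen.1 (insert x₀ (A ∩ X)) ∅
    (insert_subset hx₀ inter_subset_right) (empty_subset _) (hAX.insert _) finite_empty
    (disjoint_empty _)
  obtain ⟨y₀, hy₀, -, hy₀A⟩ := hgen.1 ∅ (A ∩ X) (empty_subset _) inter_subset_right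
    finite_empty hAX (empty_disjoint _)
  obtain ⟨x, hx, hxA, -⟩ := hgen.2 (insert y (insert y₀ (A ∩ Y))) ∅
    (insert_subset hy (insert_subset hy₀ inter_subset_right)) (empty_subset _)
    ((hAY.insert _).insert _) finite_empty (disjoint_empty _)
  refine ⟨x, hx, y, hy, fun h => ?_, fun h => ?_, hxA y (by simp), fun a ha => ⟨fun h => ?_,
    fun h => hxA a (by simp [ha, h])⟩, fun a ha => ⟨fun h => ?_, fun h => hyA a (by simp [ha, h])⟩⟩
  · exact hy₀A x ⟨h, hx⟩ (hxA y₀ (by simp)).symm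
  · exact hx₀A y ⟨h, hy⟩ (hyA x₀ (by simp)).symm
  · rcases hadj _ _ h with h' | h'
    · exact h'.2
    · exact absurd h'.1 (hXY x hx)
  · rcases hadj _ _ h with h' | h'
    · exact absurd hy (hXY y h'.1)
    · exact h'.2

theorem injective_sumElim_cond {V : Type u} {ι : Type*} {e : ι → V} (he : Function.Injective e)
    {x y : V} (hxy : x ≠ y) (hx : ∀ i, e i ≠ x) (hy : ∀ i, e i ≠ y) :
    Function.Injective (Sum.elim e fun b : Bool => cond b x y) := by
  refine he.sumElim ?_ ?_
  · rintro (_ | _) (_ | _) h <;> simp_all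
  · rintro i (_ | _)
    · exact hy i
    · exact hx i

/-- Every C-homogeneous generic bipartite graph is homogeneous bipartite. -/
theorem stmt_14 {V : Type u} (G : SimpleGraph V) (X Y : Set V)
    (hbip : IsBipartition G X Y) (hgen : GenericBip G X Y)
    (hhom : BipCHom G X Y) :
    BipHom G X Y := by
  intro A B hA hB φ hφ hφX hφY
  obtain ⟨x, hx, y, hy, hxA, hyA, hxy, hxa, hya⟩ := hgen.exists_dominating_edge hbip hA
  obtain ⟨x', hx', y', hy', hxB, hyB, hxy', hxb, hyb⟩ := hgen.exists_dominating_edge hbip hB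
  have hXY : ∀ v, v ∈ X → v ∉ Y := fun v h h' => disjoint_left.1 hbip.2.1 h h'
  have hYX : ∀ v, v ∈ Y → v ∉ X := fun v h h' => hXY v h' h
  have := hA.to_subtype
  have hxadj : ∀ a : A, G.Adj x a ↔ G.Adj x' (φ a) := fun a => by
    rw [hxa a a.2, hxb _ (φ a).2, hφY]
  have hyadj : ∀ a : A, G.Adj y a ↔ G.Adj y' (φ a) := fun a => by
    rw [hya a a.2, hyb _ (φ a).2, hφX]
  let f : A ⊕ Bool → V := Sum.elim (fun a => a.1) fun b => cond b x y
  let g : A ⊕ Bool → V := Sum.elim (fun a => (φ a).1) fun b => cond b x' y'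
  have hf : Function.Injective f := injective_sumElim_cond Subtype.val_injective hxy.ne
    (fun a h => hxA (h ▸ a.2)) (fun a h => hyA (h ▸ a.2))
  have hg : Function.Injective g := injective_sumElim_cond
    (Subtype.val_injective.comp φ.injective) hxy'.ne
    (fun a h => hxB (h ▸ (φ a).2)) (fun a h => hyB (h ▸ (φ a).2))
  have hconn : (G.induce (range f)).Connected := by
    rw [SimpleGraph.connected_iff_exists_forall_reachable]
    have hr : ∀ i j, G.Adj (f i) (f j) → (G.induce (range f)).Reachable
        ⟨f i, mem_range_self i⟩ ⟨f j, mem_range_self j⟩ := fun i j h =>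
      SimpleGraph.Adj.reachable (G := G.induce (range f)) h
    refine ⟨⟨f (.inr true), mem_range_self _⟩, ?_⟩
    rintro ⟨_, a | _ | _, rfl⟩
    · rcases (hbip.1 ▸ mem_univ a.1 : a.1 ∈ X ∪ Y) with h | h
      · exact (hr (.inr true) (.inr false) hxy).trans
          (hr (.inr false) (.inl a) ((hya a a.2).2 h))
      · exact hr (.inr true) (.inl a) ((hxa a a.2).2 h)
    · exact hr (.inr true) (.inr false) hxy
    · exact .refl _
  obtain ⟨ψ, h₁, h₂, h₃⟩ := hhom.exists_iso_of_injective hf hg hconn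
    (by
      rintro (a | _ | _) (b | _ | _) <;>
        simp [f, g, hφ, hxadj, hyadj, hxy, hxy', hxy.symm, hxy'.symm, G.adj_comm _ x,
          G.adj_comm _ y, G.adj_comm _ x', G.adj_comm _ y'])
    (by rintro (a | _ | _) <;> simp [f, g, hφX, hx, hx', hYX y hy, hYX y' hy'])
    (by rintro (a | _ | _) <;> simp [f, g, hφY, hy, hy', hXY x hx, hXY x' hx'])
  exact ⟨ψ, h₁, h₂, fun a => h₃ (.inl a)⟩
end
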